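/- arXiv:2604.18546 — 7 statements merged into one kernel-verified Lean document; each statement's English description precedes it below -/
import Mathlib

section
/- Let r > 0 and α ∈ (0,1]. Suppose the loss function ℓ : ℝ^d → ℝ is upper semicontinuous and satisfies sup_{P∈𝒫} E_P[(ℓ(z))₊] < ∞ and E_P[ℓ(z)] > −∞ for every P ∈ 𝒫. Then sup_{P∈𝒫} CVaR_P^α(ℓ(z)) = inf_{τ∈ℝ, γ≥0} { τ + (1/α)( γ r² + E_{P₀}[ φ(τ,γ,z) ] ) }, where φ(τ,γ,z) := sup_{v∈ℝ^d} { (ℓ(v)−τ)₊ − γ‖v−z‖² } takes values in [0,+∞] (it is nonnegative since v = z is feasible) and the expectation E_{P₀}[φ(τ,γ,z)] is understood as an integral with values in [0,+∞]. -/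
open MeasureTheory RealInnerProductSpace ENNReal

noncomputable section

/-- A coupling of two probability measures. -/
def IsCoupling {E : Type*} [MeasurableSpace E] (π : Measure (E × E)) (P₁ P₂ : Measure E) : Prop :=
  IsProbabilityMeasure π ∧ π.map Prod.fst = P₁ ∧ π.map Prod.snd = P₂

/-- Squared type-2 Wasserstein distance (as an infimum over couplings, in `ℝ≥0∞`). -/
def W2sq {E : Type*} [NormedAddCommGroup E] [MeasurableSpace E] (P₁ P₂ : Measure E) : ℝ≥0∞ :=
  ⨅ (π : Measure (E × E)) (_ : IsCoupling π P₁ P₂), ∫⁻ p, ENNReal.ofReal (‖p.1 - p.2‖ ^ 2) ∂π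

/-- Membership in the type-2 Wasserstein ambiguity ball of radius `r` around `P₀`:
probability measures with finite second moment at `W₂`-distance at most `r` from `P₀`. -/
def MemAmbiguity {E : Type*} [NormedAddCommGroup E] [MeasurableSpace E]
    (P₀ : Measure E) (r : ℝ) (P : Measure E) : Prop :=
  IsProbabilityMeasure P ∧ Integrable (fun z => ‖z‖ ^ 2) P ∧ W2sq P P₀ ≤ ENNReal.ofReal (r ^ 2)

/-- Conditional value-at-risk at level `α`, with values in the extended reals;
`ENNReal.ofReal (ℓ z - τ)` is the positive part `(ℓ(z) - τ)₊` viewed in `[0,∞]`. -/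
def CVaR {E : Type*} [MeasurableSpace E] (α : ℝ) (P : Measure E) (ℓ : E → ℝ) : EReal :=
  ⨅ τ : ℝ, ((τ : EReal) +
    ((1 / α : ℝ) : EReal) * ((∫⁻ z, ENNReal.ofReal (ℓ z - τ) ∂P : ℝ≥0∞) : EReal))

/-- The function `φ(τ, γ, z) = sup_v { (ℓ(v) - τ)₊ - γ‖v - z‖² }`, with values in `[0, ∞]`
(the supremum is nonnegative since `v = z` is feasible, so clamping each term at `0` via
`ENNReal.ofReal` does not change the supremum). -/
def phi {E : Type*} [NormedAddCommGroup E] (ℓ : E → ℝ) (τ γ : ℝ) (z : E) : ℝ≥0∞ :=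
  ⨆ v : E, ENNReal.ofReal (max (ℓ v - τ) 0 - γ * ‖v - z‖ ^ 2)

theorem exists_weights_le_sum_of_forall_exists_lt {V ι : Type*} [AddCommGroup V] [Module ℝ V]
    {S : Set V} (hS : S.Nonempty) {s : Finset ι} {f : ι → V → ℝ}
    (hf : ∀ i ∈ s, ConvexOn ℝ S (f i)) {c : ℝ} (hc : ∀ x ∈ S, ∃ i ∈ s, c < f i x) :
    ∃ w : ι → ℝ, (∀ i ∈ s, 0 ≤ w i) ∧ ∑ i ∈ s, w i = 1 ∧ ∀ x ∈ S, c ≤ ∑ i ∈ s, w i * f i x := by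
  classical
  obtain ⟨x₀, hx₀⟩ := hS
  obtain ⟨i₀, hi₀, -⟩ := hc x₀ hx₀
  have hSc : Convex ℝ S := (hf i₀ hi₀).1
  let A : Set (s → ℝ) := {y | ∃ x ∈ S, ∀ i : s, f i x ≤ y i}
  let B : Set (s → ℝ) := Set.univ.pi fun _ => Set.Iio c
  have hA : Convex ℝ A := by
    rintro y ⟨x, hx, hxy⟩ y' ⟨x', hx', hxy'⟩ a b ha hb hab
    refine ⟨a • x + b • x', hSc hx hx' ha hb hab, fun i => ?_⟩
    refine ((hf i i.2).2 hx hx' ha hb hab).trans ?_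
    simp only [smul_eq_mul, Pi.add_apply, Pi.smul_apply]
    exact add_le_add (mul_le_mul_of_nonneg_left (hxy i) ha)
      (mul_le_mul_of_nonneg_left (hxy' i) hb)
  have hB : Convex ℝ B := convex_pi fun _ _ => convex_Iio c
  have hBo : IsOpen B := isOpen_set_pi Set.finite_univ fun _ _ => isOpen_Iio
  have hdisj : Disjoint B A := by
    rw [Set.disjoint_left]
    rintro y hyB ⟨x, hx, hxy⟩
    obtain ⟨i, hi, hlt⟩ := hc x hx
    have h1 := hyB ⟨i, hi⟩ (Set.mem_univ _)
    have h2 := hxy ⟨i, hi⟩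
    simp only [Set.mem_Iio] at h1
    exact absurd (hlt.trans_le h2) h1.not_gt
  obtain ⟨g, u, hgB, hgA⟩ := geometric_hahn_banach_open hB hBo hA hdisj
  let v : s → ℝ := fun i => g (Pi.single i 1)
  have hg : ∀ y, g y = ∑ i, v i * y i := by
    intro y
    conv_lhs => rw [pi_eq_sum_univ' y]
    simp [v, map_sum, mul_comm]
  have hv : ∀ i, 0 ≤ v i := by
    intro i
    by_contra! hneg
    let y₀ : s → ℝ := fun j => f j x₀
    obtain ⟨n, hn⟩ := exists_nat_gt ((g y₀ - u) / (-v i))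
    rw [div_lt_iff₀ (by linarith)] at hn
    have := hgA (y₀ + (n : ℝ) • Pi.single i 1) ⟨x₀, hx₀, fun j => by
      by_cases h : j = i
      · subst h; simp [y₀]
      · simp [y₀, h]⟩
    rw [map_add, map_smul, smul_eq_mul] at this
    change u ≤ g y₀ + n * v i at this
    linarith
  have hpos : 0 < ∑ i, v i := by
    refine (Finset.sum_nonneg fun i _ => hv i).lt_of_ne' fun h0 => ?_
    have hz : ∀ i, v i = 0 := fun i =>
      (Finset.sum_eq_zero_iff_of_nonneg fun i _ => hv i).1 h0 i (Finset.mem_univ i)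
    have h1 := hgB (fun _ => c - 1) fun i _ => by simp
    have h2 := hgA (fun j => f j x₀) ⟨x₀, hx₀, fun _ => le_rfl⟩
    simp only [hg, hz, zero_mul, Finset.sum_const_zero] at h1 h2
    linarith
  have hcu : c * ∑ i, v i ≤ u := by
    refine le_of_forall_pos_lt_add fun ε hε => ?_
    have h1 := hgB (fun _ => c - ε / ∑ i, v i) fun i _ => by
      simp only [Set.mem_Iio]; have := div_pos hε hpos; linarith
    rw [hg, ← Finset.sum_mul, mul_sub, mul_div_cancel₀ _ hpos.ne'] at h1
    linarith
  refine ⟨fun i => if h : i ∈ s then v ⟨i, h⟩ / ∑ i, v i else 0, fun i hi => ?_, ?_,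
    fun x hx => ?_⟩
  · simp only [hi, dif_pos]
    exact div_nonneg (hv _) hpos.le
  · rw [← Finset.sum_coe_sort]
    simp only [Finset.coe_mem, dif_pos, Subtype.coe_eta]
    rw [← Finset.sum_div, div_self hpos.ne']
  · rw [← Finset.sum_coe_sort]
    simp only [Finset.coe_mem, dif_pos, Subtype.coe_eta]
    have h2 := hgA (fun j => f j x) ⟨x, hx, fun _ => le_rfl⟩
    rw [hg] at h2
    simp only [div_mul_eq_mul_div]
    rw [← Finset.sum_div, le_div_iff₀ hpos]
    exact hcu.trans h2

theorem exists_weights_le_sum_of_isCompact {V ι : Type*} [AddCommGroup V] [Module ℝ V]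
    [TopologicalSpace V] {S K : Set V} (hS : S.Nonempty) (hK : IsCompact K) {f : ι → V → ℝ}
    (hf : ∀ i, ConvexOn ℝ S (f i)) (hcont : ∀ i, Continuous (f i)) {c : ℝ} (i₀ : ι)
    (hout : ∀ x ∈ S, x ∉ K → c < f i₀ x) (hin : ∀ x ∈ K, ∃ i, c < f i x) :
    ∃ (s : Finset ι) (w : ι → ℝ), (∀ i ∈ s, 0 ≤ w i) ∧ ∑ i ∈ s, w i = 1 ∧
      ∀ x ∈ S, c ≤ ∑ i ∈ s, w i * f i x := by
  classical
  obtain ⟨t, ht⟩ := hK.elim_finite_subcover (fun i => {x | c < f i x})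
    (fun i => isOpen_lt continuous_const (hcont i))
    (fun x hx => Set.mem_iUnion.2 (hin x hx))
  refine ⟨insert i₀ t, exists_weights_le_sum_of_forall_exists_lt hS (fun i _ => hf i)
    fun x hx => ?_⟩
  by_cases hxK : x ∈ K
  · obtain ⟨i, hi, hlt⟩ := Set.mem_iUnion₂.1 (ht hxK)
    exact ⟨i, Finset.mem_insert_of_mem hi, hlt⟩
  · exact ⟨i₀, Finset.mem_insert_self _ _, hout x hx hxK⟩

/-- The mixture of the push-forwards of `μ` under the maps `T i`, with weights `w i`. -/
def mixtureMap {X Y ι : Type*} [MeasurableSpace X] [MeasurableSpace Y] (μ : Measure X)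
    (s : Finset ι) (w : ι → ℝ) (T : ι → X → Y) : Measure Y :=
  ∑ i ∈ s, ENNReal.ofReal (w i) • μ.map (T i)

section Mixture

variable {X Y Z ι : Type*} [MeasurableSpace X] [MeasurableSpace Y] [MeasurableSpace Z]
  {μ : Measure X} {s : Finset ι} {w : ι → ℝ} {T : ι → X → Y}

theorem lintegral_mixtureMap (hT : ∀ i ∈ s, Measurable (T i)) {g : Y → ℝ≥0∞}
    (hg : Measurable g) :
    ∫⁻ y, g y ∂(mixtureMap μ s w T) = ∑ i ∈ s, ENNReal.ofReal (w i) * ∫⁻ x, g (T i x) ∂μ := by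
  rw [mixtureMap, lintegral_finsetSum_measure]
  refine Finset.sum_congr rfl fun i hi => ?_
  rw [lintegral_smul_measure, lintegral_map hg (hT i hi), smul_eq_mul]

theorem mixtureMap_apply (hT : ∀ i ∈ s, Measurable (T i)) {B : Set Y} (hB : MeasurableSet B) :
    mixtureMap μ s w T B = ∑ i ∈ s, ENNReal.ofReal (w i) * μ (T i ⁻¹' B) := by
  rw [mixtureMap, Measure.finsetSum_apply]
  refine Finset.sum_congr rfl fun i hi => ?_
  rw [Measure.smul_apply, Measure.map_apply (hT i hi) hB, smul_eq_mul]

theorem map_mixtureMap (hT : ∀ i ∈ s, Measurable (T i)) {g : Y → Z} (hg : Measurable g) :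
    (mixtureMap μ s w T).map g = mixtureMap μ s w fun i x => g (T i x) := by
  ext B hB
  rw [Measure.map_apply hg hB, mixtureMap_apply hT (hg hB),
    mixtureMap_apply (T := fun i x => g (T i x)) (fun i hi => hg.comp (hT i hi)) hB]
  rfl

theorem sum_ofReal_weights (hw : ∀ i ∈ s, 0 ≤ w i) (hw1 : ∑ i ∈ s, w i = 1) :
    ∑ i ∈ s, ENNReal.ofReal (w i) = 1 := by
  rw [← ENNReal.ofReal_sum_of_nonneg hw, hw1, ENNReal.ofReal_one]

theorem isProbabilityMeasure_mixtureMap [IsProbabilityMeasure μ]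
    (hT : ∀ i ∈ s, Measurable (T i)) (hw : ∀ i ∈ s, 0 ≤ w i) (hw1 : ∑ i ∈ s, w i = 1) :
    IsProbabilityMeasure (mixtureMap μ s w T) :=
  ⟨by rw [mixtureMap_apply hT MeasurableSet.univ]; simp [sum_ofReal_weights hw hw1]⟩

theorem mixtureMap_const (hw : ∀ i ∈ s, 0 ≤ w i) (hw1 : ∑ i ∈ s, w i = 1) :
    mixtureMap μ s w (fun _ x => x) = μ := by
  ext B hB
  rw [mixtureMap_apply (fun _ _ => measurable_id') hB, ← Finset.sum_mul,
    sum_ofReal_weights hw hw1, one_mul]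
  rfl

theorem integrable_mixtureMap (hT : ∀ i ∈ s, Measurable (T i)) {g : Y → ℝ} (hg : Measurable g)
    (hi : ∀ i ∈ s, Integrable (fun x => g (T i x)) μ) : Integrable g (mixtureMap μ s w T) := by
  rw [mixtureMap, integrable_finsetSum_measure]
  intro i his
  refine Integrable.smul_measure ?_ ENNReal.ofReal_ne_top
  rw [integrable_map_measure hg.aestronglyMeasurable (hT i his).aemeasurable]
  exact hi i his

theorem integral_mixtureMap (hT : ∀ i ∈ s, Measurable (T i)) (hw : ∀ i ∈ s, 0 ≤ w i)
    {g : Y → ℝ} (hg : Measurable g) (hi : ∀ i ∈ s, Integrable (fun x => g (T i x)) μ) :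
    ∫ y, g y ∂(mixtureMap μ s w T) = ∑ i ∈ s, w i * ∫ x, g (T i x) ∂μ := by
  rw [mixtureMap, integral_finsetSum_measure]
  · refine Finset.sum_congr rfl fun i his => ?_
    rw [integral_smul_measure, integral_map (hT i his).aemeasurable hg.aestronglyMeasurable,
      ENNReal.toReal_ofReal (hw i his), smul_eq_mul]
  · intro i his
    refine Integrable.smul_measure ?_ ENNReal.ofReal_ne_top
    rw [integrable_map_measure hg.aestronglyMeasurable (hT i his).aemeasurable]
    exact hi i his

end Mixture

theorem integrable_norm_sub_sq {E : Type*} [NormedAddCommGroup E] [MeasurableSpace E]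
    {P₀ : Measure E} {T : E → E} (h0 : MemLp id 2 P₀) (hT : MemLp T 2 P₀) :
    Integrable (fun z => ‖T z - z‖ ^ 2) P₀ :=
  (memLp_two_iff_integrable_sq_norm (hT.sub h0).1).1 (hT.sub h0)

section Transport

variable {E : Type*} [NormedAddCommGroup E] [MeasurableSpace E] [BorelSpace E]
  [SecondCountableTopology E] {P₀ : Measure E}

theorem memAmbiguity_mixtureMap [IsProbabilityMeasure P₀] {ι : Type*} {s : Finset ι} {w : ι → ℝ}
    {T : ι → E → E} {r : ℝ} (h0 : MemLp id 2 P₀) (hT : ∀ i ∈ s, Measurable (T i))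
    (hT2 : ∀ i ∈ s, MemLp (T i) 2 P₀) (hw : ∀ i ∈ s, 0 ≤ w i) (hw1 : ∑ i ∈ s, w i = 1)
    (hr : ∑ i ∈ s, w i * ∫ z, ‖T i z - z‖ ^ 2 ∂P₀ ≤ r ^ 2) :
    MemAmbiguity P₀ r (mixtureMap P₀ s w T) := by
  have hTp : ∀ i ∈ s, Measurable fun z => (T i z, z) := fun i hi => (hT i hi).prodMk measurable_id
  refine ⟨isProbabilityMeasure_mixtureMap hT hw hw1,
    integrable_mixtureMap hT (by fun_prop) fun i hi =>
      (memLp_two_iff_integrable_sq_norm (hT2 i hi).1).1 (hT2 i hi), ?_⟩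
  have hc : IsCoupling (mixtureMap P₀ s w fun i z => (T i z, z)) (mixtureMap P₀ s w T) P₀ := by
    refine ⟨isProbabilityMeasure_mixtureMap hTp hw hw1, ?_, ?_⟩
    · rw [map_mixtureMap hTp measurable_fst]
    · rw [map_mixtureMap hTp measurable_snd]
      exact mixtureMap_const hw hw1
  refine (iInf₂_le (mixtureMap P₀ s w fun i z => (T i z, z)) hc).trans ?_
  rw [lintegral_mixtureMap hTp (by fun_prop)]
  refine le_trans (le_of_eq ?_) (ENNReal.ofReal_le_ofReal hr)
  rw [ENNReal.ofReal_sum_of_nonneg fun i hi =>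
    mul_nonneg (hw i hi) (integral_nonneg fun z => by positivity)]
  refine Finset.sum_congr rfl fun i hi => ?_
  rw [ENNReal.ofReal_mul (hw i hi), ofReal_integral_eq_lintegral_ofReal
    (integrable_norm_sub_sq h0 (hT2 i hi)) (Filter.Eventually.of_forall fun z => by positivity)]

/-- Mixing the law of `T` with `P₀` moves it into the ambiguity ball. -/
theorem lintegral_comp_lt_top_of_memAmbiguity [IsProbabilityMeasure P₀] {r : ℝ} (hr : 0 < r)
    (h0 : MemLp id 2 P₀) {T : E → E} (hT : Measurable T) (hT2 : MemLp T 2 P₀) {g : E → ℝ≥0∞}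
    (hg : Measurable g) (hfin : ∀ P, MemAmbiguity P₀ r P → ∫⁻ z, g z ∂P < ⊤) :
    ∫⁻ z, g (T z) ∂P₀ < ⊤ := by
  set C := ∫ z, ‖T z - z‖ ^ 2 ∂P₀ with hC
  have hC0 : 0 ≤ C := integral_nonneg fun z => by positivity
  let ε : ℝ := r ^ 2 / (r ^ 2 + C)
  have hr2 : 0 < r ^ 2 := by positivity
  have hε0 : 0 < ε := by positivity
  have hε1 : ε ≤ 1 := (div_le_one (by positivity)).2 (by linarith)
  have hεC : ε * C ≤ r ^ 2 := by
    rw [div_mul_eq_mul_div, div_le_iff₀ (by positivity)]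
    nlinarith
  let S : Bool → E → E := fun b => if b then T else id
  let w : Bool → ℝ := fun b => if b then ε else 1 - ε
  have hS : ∀ b ∈ Finset.univ, Measurable (S b) := by
    rintro (_ | _) - <;> simp [S, hT, measurable_id]
  have hmem : MemAmbiguity P₀ r (mixtureMap P₀ Finset.univ w S) := by
    refine memAmbiguity_mixtureMap h0 hS ?_ ?_ ?_ ?_
    · rintro (_ | _) -
      · simpa [S] using h0
      · simpa [S] using hT2
    · rintro (_ | _) - <;> simp [w, hε0.le, hε1]
    · simp [w]
    · simpa [w, S, ← hC] using hεC
  have := hfin _ hmem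
  rw [lintegral_mixtureMap hS hg] at this
  have h1 := (ENNReal.sum_lt_top.1 this) true (Finset.mem_univ _)
  refine (ENNReal.lt_top_of_mul_ne_top_right h1.ne ?_)
  simpa [w] using hε0

theorem integrable_comp_of_memAmbiguity [IsProbabilityMeasure P₀] {r : ℝ} (hr : 0 < r)
    (h0 : MemLp id 2 P₀) {ℓ : E → ℝ} (hℓ : Measurable ℓ)
    (hpos : ∀ P, MemAmbiguity P₀ r P → ∫⁻ z, ENNReal.ofReal (ℓ z) ∂P < ⊤)
    (hneg : ∀ P, MemAmbiguity P₀ r P → ∫⁻ z, ENNReal.ofReal (-(ℓ z)) ∂P < ⊤)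
    {T : E → E} (hT : Measurable T) (hT2 : MemLp T 2 P₀) :
    Integrable (fun z => ℓ (T z)) P₀ := by
  refine ⟨(hℓ.comp hT).aestronglyMeasurable, ?_⟩
  have h1 := lintegral_comp_lt_top_of_memAmbiguity hr h0 hT hT2
    (g := fun z => ENNReal.ofReal (ℓ z)) (by fun_prop) hpos
  have h2 := lintegral_comp_lt_top_of_memAmbiguity hr h0 hT hT2
    (g := fun z => ENNReal.ofReal (-(ℓ z))) (by fun_prop) hneg
  refine lt_of_le_of_lt ?_ (ENNReal.add_lt_top.2 ⟨h1, h2⟩)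
  rw [← lintegral_add_left (by fun_prop)]
  refine lintegral_mono fun z => ?_
  rw [← ofReal_norm, Real.norm_eq_abs]
  rcases le_total 0 (ℓ (T z)) with h | h
  · rw [abs_of_nonneg h]; exact le_self_add
  · rw [abs_of_nonpos h]; exact le_add_self

end Transport

/-- The loss is determined, up to closure of its graph, by its values on a sequence. -/
theorem exists_seq_graph_dense {E : Type*} [TopologicalSpace E]
    [SecondCountableTopology E] [Nonempty E] (ℓ : E → ℝ) :
    ∃ u : ℕ → E, ∀ (H : E × ℝ → ℝ≥0∞), Continuous H → ∀ v, H (v, ℓ v) ≤ ⨆ n, H (u n, ℓ (u n)) := by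
  have : Nonempty (Set.range fun v => (v, ℓ v)) := ⟨⟨_, Classical.arbitrary E, rfl⟩⟩
  obtain ⟨q, hq⟩ := TopologicalSpace.exists_dense_seq (Set.range fun v => (v, ℓ v))
  refine ⟨fun n => (q n).1.1, fun H hH v => ?_⟩
  have hqn : ∀ n, ((q n).1.1, ℓ (q n).1.1) = (q n).1 := by
    intro n
    obtain ⟨x, hx⟩ := (q n).2
    rw [← hx]
  simp only [hqn]
  have hcl : IsClosed {p : Set.range fun v => (v, ℓ v) | H p ≤ ⨆ n, H (q n)} :=
    isClosed_le (hH.comp continuous_subtype_val) continuous_const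
  have hsub : Set.range q ⊆ {p : Set.range fun v => (v, ℓ v) | H p ≤ ⨆ n, H (q n)} := by
    rintro _ ⟨n, rfl⟩
    exact le_iSup (fun n => H (q n)) n
  exact hcl.closure_subset_iff.2 hsub (hq (⟨(v, ℓ v), v, rfl⟩ : Set.range fun v => (v, ℓ v)))

/-- The map that picks, at each `z`, the one of `T z`, `T' z` with the larger value of `h · z`
(and `T z` if the two values agree). -/
def pickBetter {E : Type*} (h : E → E → ℝ) (T T' : E → E) : E → E := fun z =>
  open Classical in if h (T z) z < h (T' z) z then T' z else T z

/-- Greedy maximisation of `h · z` over the points `z, u 0, u 1, …`. -/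
def greedy {E : Type*} (h : E → E → ℝ) (u : ℕ → E) : ℕ → E → E
  | 0 => id
  | n + 1 => pickBetter h (greedy h u n) fun _ => u n

section Selection

variable {E : Type*} {h : E → E → ℝ} {T T' : E → E} {u : ℕ → E}

theorem apply_pickBetter (z : E) :
    h (pickBetter h T T' z) z = max (h (T z) z) (h (T' z) z) := by
  unfold pickBetter
  split_ifs with hlt
  · exact (max_eq_right hlt.le).symm
  · exact (max_eq_left (not_lt.1 hlt)).symm

theorem measurable_pickBetter [MeasurableSpace E] (hh : Measurable (Function.uncurry h))
    (hT : Measurable T) (hT' : Measurable T') : Measurable (pickBetter h T T') :=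
  Measurable.ite (measurableSet_lt (hh.comp (hT.prodMk measurable_id))
    (hh.comp (hT'.prodMk measurable_id))) hT' hT

theorem memLp_pickBetter [NormedAddCommGroup E] [MeasurableSpace E] [BorelSpace E]
    [SecondCountableTopology E] {P₀ : Measure E} (hh : Measurable (Function.uncurry h))
    (hT : Measurable T) (hT' : Measurable T') (hT2 : MemLp T 2 P₀) (hT2' : MemLp T' 2 P₀) :
    MemLp (pickBetter h T T') 2 P₀ := by
  refine (hT2.norm.add hT2'.norm).mono' (measurable_pickBetter hh hT hT').aestronglyMeasurable
    (Filter.Eventually.of_forall fun z => ?_)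
  simp only [pickBetter, Pi.add_apply]
  split_ifs
  · exact le_add_of_nonneg_left (norm_nonneg _)
  · exact le_add_of_nonneg_right (norm_nonneg _)

theorem monotone_greedy (z : E) : Monotone fun n => h (greedy h u n z) z :=
  monotone_nat_of_le_succ fun n => by
    simp only [greedy, apply_pickBetter]
    exact le_max_left _ _

theorem measurable_greedy [MeasurableSpace E] (hh : Measurable (Function.uncurry h)) (n : ℕ) :
    Measurable (greedy h u n) := by
  induction n with
  | zero => exact measurable_id
  | succ n ih => exact measurable_pickBetter hh ih measurable_const

theorem memLp_greedy [NormedAddCommGroup E] [MeasurableSpace E] [BorelSpace E]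
    [SecondCountableTopology E] {P₀ : Measure E} [IsFiniteMeasure P₀]
    (hh : Measurable (Function.uncurry h)) (h0 : MemLp id 2 P₀) (n : ℕ) :
    MemLp (greedy h u n) 2 P₀ := by
  induction n with
  | zero => exact h0
  | succ n ih =>
    exact memLp_pickBetter hh (measurable_greedy hh n) measurable_const ih (memLp_const _)

end Selection

theorem integrable_max_sub {E : Type*} [MeasurableSpace E] {P₀ : Measure E}
    [IsFiniteMeasure P₀] {g : E → ℝ} (hg : Integrable g P₀) (τ : ℝ) :
    Integrable (fun z => max (g z - τ) 0) P₀ :=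
  (hg.sub (integrable_const τ)).pos_part

theorem continuous_integral_max_sub {E : Type*} [MeasurableSpace E] {P₀ : Measure E}
    [IsFiniteMeasure P₀] {g : E → ℝ} (hg : Integrable g P₀) :
    Continuous fun τ : ℝ => ∫ z, max (g z - τ) 0 ∂P₀ := by
  refine continuous_iff_continuousAt.2 fun τ₀ => ?_
  refine continuousAt_of_dominated (bound := fun z => |g z| + (|τ₀| + 1))
    (Filter.Eventually.of_forall fun τ => (integrable_max_sub hg τ).aestronglyMeasurable)
    ?_ (hg.abs.add (integrable_const _)) (Filter.Eventually.of_forall fun z => by fun_prop)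
  filter_upwards [Metric.ball_mem_nhds τ₀ one_pos] with τ hτ
  refine Filter.Eventually.of_forall fun z => ?_
  rw [Metric.mem_ball, Real.dist_eq] at hτ
  rw [Real.norm_eq_abs, abs_of_nonneg (le_max_right _ _)]
  have h1 := abs_sub_abs_le_abs_sub τ τ₀
  have h2 := le_abs_self (g z)
  have h3 := neg_abs_le τ
  have h4 := abs_nonneg (g z)
  have h5 := abs_nonneg τ₀
  exact max_le (by linarith) (by linarith)

theorem nonneg_of_forall_le_add_mul {a b D : ℝ} (h : ∀ t : ℝ, 0 ≤ t → a ≤ b + t * D) :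
    0 ≤ D := by
  by_contra! hD
  obtain ⟨n, hn⟩ := exists_nat_gt ((b - a) / -D)
  rw [div_lt_iff₀ (by linarith)] at hn
  linarith [h n n.cast_nonneg]

theorem exists_integral_max_sub_lt {E : Type*} [MeasurableSpace E] {P₀ : Measure E}
    {ℓ : E → ℝ} [IsFiniteMeasure P₀] (hℓP : Integrable ℓ P₀) {ε : ℝ}
    (hε : 0 < ε) : ∃ τ : ℝ, ∫ z, max (τ - ℓ z) 0 ∂P₀ < ε := by
  have : Filter.Tendsto (fun τ : ℝ => ∫ z, max (τ - ℓ z) 0 ∂P₀) Filter.atBot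
      (nhds (∫ _, (0 : ℝ) ∂P₀)) := by
    refine tendsto_integral_filter_of_dominated_convergence (fun z => |ℓ z|)
      (Filter.Eventually.of_forall fun τ =>
        (((integrable_const τ).sub hℓP).pos_part).aestronglyMeasurable)
      ?_ hℓP.abs (Filter.Eventually.of_forall fun z => ?_)
    · filter_upwards [Filter.eventually_le_atBot (0 : ℝ)] with τ hτ
      refine Filter.Eventually.of_forall fun z => ?_
      rw [Real.norm_eq_abs, abs_of_nonneg (le_max_right _ _)]
      exact max_le (by linarith [neg_abs_le (ℓ z)]) (abs_nonneg _)
    · refine tendsto_const_nhds.congr' ?_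
      filter_upwards [Filter.eventually_le_atBot (ℓ z)] with τ hτ
      rw [max_eq_right (by linarith)]
  rw [integral_zero] at this
  exact (this.eventually (gt_mem_nhds hε)).exists

theorem coe_le_CVaR {E : Type*} [MeasurableSpace E] {ℓ : E → ℝ} {α : ℝ} {P : Measure E}
    [IsProbabilityMeasure P] (hℓP : Integrable ℓ P) {c : ℝ}
    (h : ∀ τ : ℝ, c ≤ τ + 1 / α * ∫ z, max (ℓ z - τ) 0 ∂P) : (c : EReal) ≤ CVaR α P ℓ := by
  refine le_iInf fun τ => ?_
  have h1 : ∫⁻ z, ENNReal.ofReal (ℓ z - τ) ∂P = ENNReal.ofReal (∫ z, max (ℓ z - τ) 0 ∂P) := by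
    rw [ofReal_integral_eq_lintegral_ofReal (integrable_max_sub hℓP τ)
      (Filter.Eventually.of_forall fun z => le_max_right _ _)]
    refine lintegral_congr fun z => ?_
    rw [ENNReal.ofReal_max, ENNReal.ofReal_zero, max_eq_left zero_le]
  rw [h1, EReal.coe_ennreal_ofReal,
    max_eq_left (a := ∫ z, max (ℓ z - τ) 0 ∂P) (integral_nonneg fun z => le_max_right _ _),
    ← EReal.coe_mul, ← EReal.coe_add]
  exact EReal.coe_le_coe_iff.2 (h τ)

/-- The objective in the supremum that defines `phi`. -/
def penalized {E : Type*} [NormedAddCommGroup E] (ℓ : E → ℝ) (τ γ : ℝ) (v z : E) : ℝ :=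
  max (ℓ v - τ) 0 - γ * ‖v - z‖ ^ 2

theorem exists_phi_eq_iSup_greedy {E : Type*} [NormedAddCommGroup E]
    [SecondCountableTopology E] (ℓ : E → ℝ) (τ γ : ℝ) : ∃ u : ℕ → E, ∀ z,
    phi ℓ τ γ z = ⨆ n, ENNReal.ofReal
      (penalized ℓ τ γ (greedy (penalized ℓ τ γ) u n z) z) := by
  obtain ⟨u, hu⟩ := exists_seq_graph_dense ℓ
  refine ⟨u, fun z => le_antisymm (iSup_le fun v => ?_) (iSup_le fun n => ?_)⟩
  · refine (hu (fun p => ENNReal.ofReal (max (p.2 - τ) 0 - γ * ‖p.1 - z‖ ^ 2))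
      (ENNReal.continuous_ofReal.comp (by fun_prop)) v).trans (iSup_le fun n => ?_)
    refine le_iSup_of_le (n + 1) (ENNReal.ofReal_le_ofReal ?_)
    simp only [greedy, apply_pickBetter]
    exact le_max_right _ _
  · exact le_iSup (fun v => ENNReal.ofReal (max (ℓ v - τ) 0 - γ * ‖v - z‖ ^ 2)) _

section Lagrangian

variable {E : Type*} [NormedAddCommGroup E] [MeasurableSpace E] {P₀ : Measure E} {ℓ : E → ℝ}
  {T : E → E} {r α : ℝ}

/-- The Lagrangian of the worst-case CVaR problem at the transport map `T`, as a function of the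
multipliers `(τ, γ)`. -/
def lagrangian (P₀ : Measure E) (ℓ : E → ℝ) (r α : ℝ) (T : E → E) (x : ℝ × ℝ) : ℝ :=
  x.1 + 1 / α * (∫ z, max (ℓ (T z) - x.1) 0 ∂P₀ + x.2 * (r ^ 2 - ∫ z, ‖T z - z‖ ^ 2 ∂P₀))

theorem convexOn_lagrangian [IsProbabilityMeasure P₀] (hα : 0 < α)
    (hℓT : Integrable (fun z => ℓ (T z)) P₀) {S : Set (ℝ × ℝ)} (hS : Convex ℝ S) :
    ConvexOn ℝ S (lagrangian P₀ ℓ r α T) := by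
  refine ⟨hS, fun x _ y _ a b ha hb hab => ?_⟩
  have hcomp : ∫ z, max (ℓ (T z) - (a * x.1 + b * y.1)) 0 ∂P₀ ≤
      a * ∫ z, max (ℓ (T z) - x.1) 0 ∂P₀ + b * ∫ z, max (ℓ (T z) - y.1) 0 ∂P₀ := by
    have hx := (integrable_max_sub hℓT x.1).const_mul a
    have hy := (integrable_max_sub hℓT y.1).const_mul b
    rw [← integral_const_mul, ← integral_const_mul, ← integral_add hx hy]
    refine integral_mono (integrable_max_sub hℓT _) (hx.add hy) fun z => ?_
    obtain rfl : b = 1 - a := by linarith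
    refine max_le ?_ (by positivity)
    have h1 := mul_le_mul_of_nonneg_left (le_max_left (ℓ (T z) - x.1) 0) ha
    have h2 := mul_le_mul_of_nonneg_left (le_max_left (ℓ (T z) - y.1) 0) hb
    linarith
  simp only [lagrangian, Prod.fst_add, Prod.snd_add, Prod.smul_fst, Prod.smul_snd, smul_eq_mul]
  have := mul_le_mul_of_nonneg_left hcomp (one_div_pos.2 hα).le
  linarith

theorem continuous_lagrangian [IsProbabilityMeasure P₀]
    (hℓT : Integrable (fun z => ℓ (T z)) P₀) : Continuous (lagrangian P₀ ℓ r α T) := by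
  have := (continuous_integral_max_sub hℓT).comp (continuous_fst (X := ℝ) (Y := ℝ))
  unfold lagrangian
  simp only [Function.comp_def] at this
  fun_prop

end Lagrangian

section Duality

variable {E : Type*} [NormedAddCommGroup E] [MeasurableSpace E] [BorelSpace E]
  [SecondCountableTopology E] {P₀ : Measure E} {ℓ : E → ℝ} {T : E → E} {r α : ℝ}

theorem measurable_penalized (hℓ : Measurable ℓ) (τ γ : ℝ) :
    Measurable (Function.uncurry (penalized ℓ τ γ)) := by
  unfold penalized Function.uncurry
  fun_prop

theorem measurable_phi (hℓ : Measurable ℓ) (τ γ : ℝ) : Measurable (phi ℓ τ γ) := by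
  obtain ⟨u, hu⟩ := exists_phi_eq_iSup_greedy ℓ τ γ
  rw [funext hu]
  have hh := measurable_penalized hℓ τ γ
  exact Measurable.iSup fun n =>
    ENNReal.measurable_ofReal.comp (hh.comp ((measurable_greedy hh n).prodMk measurable_id))

theorem exists_lt_lintegral_penalized [IsFiniteMeasure P₀] (h0 : MemLp id 2 P₀)
    (hℓ : Measurable ℓ) {τ γ : ℝ} {b : ℝ≥0∞} (hb : b < ∫⁻ z, phi ℓ τ γ z ∂P₀) :
    ∃ T : E → E, Measurable T ∧ MemLp T 2 P₀ ∧ (∀ z, 0 ≤ penalized ℓ τ γ (T z) z) ∧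
      b < ∫⁻ z, ENNReal.ofReal (penalized ℓ τ γ (T z) z) ∂P₀ := by
  obtain ⟨u, hu⟩ := exists_phi_eq_iSup_greedy ℓ τ γ
  have hh := measurable_penalized hℓ τ γ
  have hm : ∀ n, Measurable fun z => ENNReal.ofReal
      (penalized ℓ τ γ (greedy (penalized ℓ τ γ) u n z) z) := fun n =>
    ENNReal.measurable_ofReal.comp (hh.comp ((measurable_greedy hh n).prodMk measurable_id))
  rw [lintegral_congr hu, lintegral_iSup hm
    fun m n hmn z => ENNReal.ofReal_le_ofReal (monotone_greedy z hmn), lt_iSup_iff] at hb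
  obtain ⟨n, hn⟩ := hb
  refine ⟨_, measurable_greedy hh n, memLp_greedy hh h0 n, fun z => ?_, hn⟩
  refine le_trans ?_ (monotone_greedy (h := penalized ℓ τ γ) (u := u) z (Nat.zero_le n))
  simp [greedy, penalized]

theorem lintegral_le_add_lintegral_phi (hℓ : Measurable ℓ) {P : Measure E}
    (hP : MemAmbiguity P₀ r P) (τ : ℝ) {γ : ℝ} (hγ : 0 ≤ γ) :
    ∫⁻ z, ENNReal.ofReal (ℓ z - τ) ∂P ≤
      ENNReal.ofReal (γ * r ^ 2) + ∫⁻ z, phi ℓ τ γ z ∂P₀ := by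
  obtain ⟨-, -, hW⟩ := hP
  have key : ∀ π : Measure (E × E), IsCoupling π P P₀ →
      ∫⁻ z, ENNReal.ofReal (ℓ z - τ) ∂P ≤
        ENNReal.ofReal γ * (∫⁻ p, ENNReal.ofReal (‖p.1 - p.2‖ ^ 2) ∂π) +
          ∫⁻ z, phi ℓ τ γ z ∂P₀ := by
    rintro π ⟨-, h1, h2⟩
    rw [← h1, ← h2, lintegral_map (by fun_prop) measurable_fst,
      lintegral_map (measurable_phi hℓ τ γ) measurable_snd,
      ← lintegral_const_mul _ (by fun_prop), ← lintegral_add_left (by fun_prop)]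
    refine lintegral_mono fun p => ?_
    rw [← ENNReal.ofReal_mul hγ]
    refine le_trans ?_ (add_le_add le_rfl (le_iSup (fun v => ENNReal.ofReal
      (max (ℓ v - τ) 0 - γ * ‖v - p.2‖ ^ 2)) p.1))
    refine le_trans (ENNReal.ofReal_le_ofReal ?_) ENNReal.ofReal_add_le
    linarith [le_max_left (ℓ p.1 - τ) 0]
  have hlim : Filter.Tendsto (fun t : ℝ≥0∞ => ENNReal.ofReal γ * t + ∫⁻ z, phi ℓ τ γ z ∂P₀)
      (nhdsWithin (ENNReal.ofReal (r ^ 2)) (Set.Ioi (ENNReal.ofReal (r ^ 2))))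
      (nhds (ENNReal.ofReal γ * ENNReal.ofReal (r ^ 2) + ∫⁻ z, phi ℓ τ γ z ∂P₀)) :=
    Filter.Tendsto.mono_left ((ENNReal.Tendsto.const_mul Filter.tendsto_id
      (Or.inr ENNReal.ofReal_ne_top)).add_const _) nhdsWithin_le_nhds
  rw [ENNReal.ofReal_mul hγ]
  have : (nhdsWithin (ENNReal.ofReal (r ^ 2)) (Set.Ioi (ENNReal.ofReal (r ^ 2)))).NeBot :=
    nhdsGT_neBot_of_exists_gt ⟨⊤, ENNReal.ofReal_lt_top⟩
  refine ge_of_tendsto hlim (eventually_nhdsWithin_of_forall fun t ht => ?_)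
  obtain ⟨π, hπ⟩ := iInf_lt_iff.1 (hW.trans_lt ht)
  obtain ⟨hπc, hπt⟩ := iInf_lt_iff.1 hπ
  refine (key π hπc).trans ?_
  gcongr

theorem exists_lt_lagrangian [IsProbabilityMeasure P₀] (h0 : MemLp id 2 P₀) (hℓ : Measurable ℓ)
    (hα : 0 < α)
    (hcomp : ∀ T : E → E, Measurable T → MemLp T 2 P₀ → Integrable (fun z => ℓ (T z)) P₀)
    {c τ γ : ℝ} (hγ : 0 ≤ γ)
    (hc : (c : EReal) < (τ : EReal) + ((1 / α : ℝ) : EReal) *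
      ((ENNReal.ofReal (γ * r ^ 2) + ∫⁻ z, phi ℓ τ γ z ∂P₀ : ℝ≥0∞) : EReal)) :
    ∃ T : E → E, Measurable T ∧ MemLp T 2 P₀ ∧ c < lagrangian P₀ ℓ r α T (τ, γ) := by
  have hpen : ∀ T : E → E, Measurable T → MemLp T 2 P₀ →
      Integrable (fun z => penalized ℓ τ γ (T z) z) P₀ ∧
        ∫ z, penalized ℓ τ γ (T z) z ∂P₀ =
          ∫ z, max (ℓ (T z) - τ) 0 ∂P₀ - γ * ∫ z, ‖T z - z‖ ^ 2 ∂P₀ := by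
    intro T hT hT2
    have h1 := integrable_max_sub (hcomp T hT hT2) τ
    have h2 := (integrable_norm_sub_sq h0 hT2).const_mul γ
    refine ⟨h1.sub h2, ?_⟩
    rw [← integral_const_mul, ← integral_sub h1 h2]
    rfl
  suffices ∃ T : E → E, Measurable T ∧ MemLp T 2 P₀ ∧
      α * (c - τ) - γ * r ^ 2 < ∫ z, penalized ℓ τ γ (T z) z ∂P₀ by
    obtain ⟨T, hT, hT2, hlt⟩ := this
    refine ⟨T, hT, hT2, ?_⟩
    rw [(hpen T hT hT2).2] at hlt
    simp only [lagrangian]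
    rw [← sub_lt_iff_lt_add', one_div, ← div_eq_inv_mul, lt_div_iff₀ hα]
    linarith
  rcases lt_or_ge (α * (c - τ) - γ * r ^ 2) 0 with hb | hb
  · refine ⟨id, measurable_id, h0, hb.trans_le (integral_nonneg fun z => ?_)⟩
    simp [penalized]
  · have hlt : ENNReal.ofReal (α * (c - τ) - γ * r ^ 2) < ∫⁻ z, phi ℓ τ γ z ∂P₀ := by
      by_contra! hle
      refine hc.not_ge ?_
      have h1 : ENNReal.ofReal (γ * r ^ 2) + ∫⁻ z, phi ℓ τ γ z ∂P₀ ≤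
          ENNReal.ofReal (α * (c - τ)) := by
        refine (add_le_add le_rfl hle).trans (le_of_eq ?_)
        rw [← ENNReal.ofReal_add (by positivity) hb]
        ring_nf
      have h2 : ((ENNReal.ofReal (γ * r ^ 2) + ∫⁻ z, phi ℓ τ γ z ∂P₀ : ℝ≥0∞) : EReal) ≤
          ((α * (c - τ) : ℝ) : EReal) := by
        refine (EReal.coe_ennreal_le_coe_ennreal_iff.2 h1).trans (le_of_eq ?_)
        rw [EReal.coe_ennreal_ofReal, max_eq_left]
        nlinarith [mul_nonneg hγ (sq_nonneg r)]
      calc (τ : EReal) + ((1 / α : ℝ) : EReal) * _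
          ≤ (τ : EReal) + ((1 / α : ℝ) : EReal) * ((α * (c - τ) : ℝ) : EReal) :=
            add_le_add le_rfl (mul_le_mul_of_nonneg_left h2
              (EReal.coe_nonneg.2 (one_div_pos.2 hα).le))
        _ = (c : EReal) := by
            rw [← EReal.coe_mul, ← EReal.coe_add]
            congr 1
            field_simp
            ring
    obtain ⟨T, hT, hT2, hnn, hTlt⟩ := exists_lt_lintegral_penalized h0 hℓ hlt
    refine ⟨T, hT, hT2, ?_⟩
    rw [← ofReal_integral_eq_lintegral_ofReal (hpen T hT hT2).1
      (Filter.Eventually.of_forall hnn)] at hTlt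
    exact (ENNReal.ofReal_lt_ofReal_iff_of_nonneg hb).1 hTlt

theorem exists_memAmbiguity_of_lt_one [IsProbabilityMeasure P₀] (h0 : MemLp id 2 P₀)
    (hℓ : Measurable ℓ) (hr : 0 < r) (hα : 0 < α) (hα1 : α < 1)
    (hcomp : ∀ T : E → E, Measurable T → MemLp T 2 P₀ → Integrable (fun z => ℓ (T z)) P₀)
    {c : ℝ} (hc : ∀ τ γ : ℝ, 0 ≤ γ → ∃ T : E → E, Measurable T ∧ MemLp T 2 P₀ ∧
      c < lagrangian P₀ ℓ r α T (τ, γ)) :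
    ∃ P, MemAmbiguity P₀ r P ∧ (c : EReal) ≤ CVaR α P ℓ := by
  let ι := {T : E → E // Measurable T ∧ MemLp T 2 P₀}
  let f : ι → ℝ × ℝ → ℝ := fun T => lagrangian P₀ ℓ r α T.1
  let m := ∫ z, ℓ z ∂P₀
  let β := 1 / α - 1
  have hβ : 0 < β := sub_pos.2 ((one_lt_div hα).2 hα1)
  let a := -((c - 1 / α * m) / β)
  have hr2 : 0 < r ^ 2 := by positivity
  let Γ := α * (c - a) / r ^ 2
  have hid : Integrable ℓ P₀ := hcomp id measurable_id h0
  obtain ⟨s, w, hw, hw1, hsum⟩ := exists_weights_le_sum_of_isCompact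
    (S := Set.univ ×ˢ Set.Ici (0 : ℝ)) (K := Set.Icc a c ×ˢ Set.Icc 0 Γ) (f := f)
    ⟨(0, 0), by simp⟩ (isCompact_Icc.prod isCompact_Icc)
    (fun T => convexOn_lagrangian hα (hcomp T.1 T.2.1 T.2.2) (convex_univ.prod (convex_Ici 0)))
    (fun T => continuous_lagrangian (hcomp T.1 T.2.1 T.2.2)) (c := c) ⟨id, measurable_id, h0⟩
    (by
      rintro ⟨τ, γ⟩ ⟨-, hγ⟩ hK
      simp only [Set.mem_Ici] at hγ
      have e : f ⟨id, measurable_id, h0⟩ (τ, γ) =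
          τ + 1 / α * (∫ z, max (ℓ z - τ) 0 ∂P₀) + 1 / α * (γ * r ^ 2) := by
        simp [f, lagrangian]
        ring
      rw [e]
      have hα' : 0 < 1 / α := one_div_pos.2 hα
      have h1 : 0 ≤ 1 / α * ∫ z, max (ℓ z - τ) 0 ∂P₀ :=
        mul_nonneg hα'.le (integral_nonneg fun z => le_max_right _ _)
      have h2 : 1 / α * (m - τ) ≤ 1 / α * ∫ z, max (ℓ z - τ) 0 ∂P₀ := by
        refine mul_le_mul_of_nonneg_left ?_ hα'.le
        have : m - τ = ∫ z, (ℓ z - τ) ∂P₀ := by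
          rw [integral_sub hid (integrable_const τ)]
          simp [m]
        rw [this]
        exact integral_mono (hid.sub (integrable_const τ)) (integrable_max_sub hid τ)
          fun z => le_max_left _ _
      have h3 : 0 ≤ 1 / α * (γ * r ^ 2) := by positivity
      rcases lt_or_ge c τ with hτ | hτ
      · linarith
      rcases lt_or_ge τ a with hτa | hτa
      · have h4 : (c - 1 / α * m) / β < -τ := by simp only [a] at hτa; linarith
        rw [div_lt_iff₀ hβ] at h4
        simp only [β] at h4
        linarith
      · have hΓ : Γ < γ := by
          by_contra! hle
          exact hK ⟨⟨hτa, hτ⟩, hγ, hle⟩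
        simp only [Γ] at hΓ
        rw [div_lt_iff₀ hr2] at hΓ
        have h4 : c - a < 1 / α * (γ * r ^ 2) := by
          rw [one_div, ← div_eq_inv_mul, lt_div_iff₀ hα]
          linarith
        linarith)
    (by
      rintro ⟨τ, γ⟩ ⟨-, hγ, -⟩
      obtain ⟨T, hT, hT2, hlt⟩ := hc τ γ hγ
      exact ⟨⟨T, hT, hT2⟩, hlt⟩)
  let P := mixtureMap P₀ s w fun T : ι => T.1
  have hT : ∀ T ∈ s, Measurable (T : ι).1 := fun T _ => T.2.1
  let D := r ^ 2 - ∑ T ∈ s, w T * ∫ z, ‖T.1 z - z‖ ^ 2 ∂P₀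
  have hval : ∀ τ γ : ℝ, 0 ≤ γ →
      c ≤ (τ + 1 / α * ∫ z, max (ℓ z - τ) 0 ∂P) + γ * (1 / α * D) := by
    intro τ γ hγ
    refine (hsum (τ, γ) ⟨Set.mem_univ _, hγ⟩).trans (le_of_eq ?_)
    rw [integral_mixtureMap hT hw (g := fun z => max (ℓ z - τ) 0) (by fun_prop)
      fun T _ => integrable_max_sub (hcomp T.1 T.2.1 T.2.2) τ]
    have e : ∀ T ∈ s, w T * f T (τ, γ) = w T * τ +
        1 / α * (w T * ∫ z, max (ℓ (T.1 z) - τ) 0 ∂P₀) + γ / α * (w T * r ^ 2) -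
        γ / α * (w T * ∫ z, ‖T.1 z - z‖ ^ 2 ∂P₀) := fun T _ => by
      simp only [f, lagrangian]
      ring
    rw [Finset.sum_congr rfl e, Finset.sum_sub_distrib, Finset.sum_add_distrib,
      Finset.sum_add_distrib, ← Finset.mul_sum, ← Finset.mul_sum, ← Finset.mul_sum,
      ← Finset.sum_mul, ← Finset.sum_mul, hw1]
    simp only [D]
    ring
  have hD : 0 ≤ D := by
    have := nonneg_of_forall_le_add_mul fun t ht => hval 0 t ht
    exact nonneg_of_mul_nonneg_right this (one_div_pos.2 hα)
  have hmem : MemAmbiguity P₀ r P := memAmbiguity_mixtureMap h0 hT (fun T _ => T.2.2) hw hw1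
    (by simp only [D] at hD; linarith)
  have := hmem.1
  exact ⟨P, hmem, coe_le_CVaR (integrable_mixtureMap hT hℓ fun T _ => hcomp T.1 T.2.1 T.2.2)
    fun τ => by simpa using hval τ 0 le_rfl⟩

theorem exists_lt_integral_add_of_lagrangian [IsProbabilityMeasure P₀] (h0 : MemLp id 2 P₀)
    (hℓ : Measurable ℓ)
    (hcomp : ∀ T : E → E, Measurable T → MemLp T 2 P₀ → Integrable (fun z => ℓ (T z)) P₀)
    {c c' : ℝ} (hcc : c < c') {γ : ℝ} (hγ : 0 ≤ γ)
    (hc : ∀ τ : ℝ, ∃ T : E → E, Measurable T ∧ MemLp T 2 P₀ ∧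
      c' < lagrangian P₀ ℓ r 1 T (τ, γ)) :
    ∃ T : E → E, Measurable T ∧ MemLp T 2 P₀ ∧
      c < ∫ z, ℓ (T z) ∂P₀ + γ * (r ^ 2 - ∫ z, ‖T z - z‖ ^ 2 ∂P₀) := by
  have hid : Integrable ℓ P₀ := hcomp id measurable_id h0
  obtain ⟨τ, hτ⟩ := exists_integral_max_sub_lt hid (sub_pos.2 hcc)
  obtain ⟨T, hT, hT2, hlt⟩ := hc τ
  let h : E → E → ℝ := fun v z => ℓ v - γ * ‖v - z‖ ^ 2
  have hh : Measurable (Function.uncurry h) := by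
    unfold h Function.uncurry
    fun_prop
  let T' := pickBetter h T id
  have hT' : Measurable T' := measurable_pickBetter hh hT measurable_id
  have hT2' : MemLp T' 2 P₀ := memLp_pickBetter hh hT measurable_id hT2 h0
  refine ⟨T', hT', hT2', ?_⟩
  have i1 := integrable_max_sub (hcomp T hT hT2) τ
  have i2 := (integrable_norm_sub_sq h0 hT2).const_mul γ
  have i3 := hcomp T' hT' hT2'
  have i4 := (integrable_norm_sub_sq h0 hT2').const_mul γ
  have i5 : Integrable (fun z => max (τ - ℓ z) 0) P₀ := ((integrable_const τ).sub hid).pos_part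
  have key : ∫ z, (max (ℓ (T z) - τ) 0 - γ * ‖T z - z‖ ^ 2) ∂P₀ ≤
      ∫ z, (ℓ (T' z) - γ * ‖T' z - z‖ ^ 2 + max (τ - ℓ z) 0 - τ) ∂P₀ := by
    refine integral_mono (i1.sub i2) (((i3.sub i4).add i5).sub (integrable_const τ)) fun z => ?_
    have e : ℓ (T' z) - γ * ‖T' z - z‖ ^ 2 =
        max (ℓ (T z) - γ * ‖T z - z‖ ^ 2) (ℓ z) := by
      have := apply_pickBetter (h := h) (T := T) (T' := id) z
      simpa [h] using this
    have e1 := le_max_left (ℓ (T z) - γ * ‖T z - z‖ ^ 2) (ℓ z)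
    have e2 := le_max_right (ℓ (T z) - γ * ‖T z - z‖ ^ 2) (ℓ z)
    have e3 := le_max_left (τ - ℓ z) 0
    have e4 := le_max_right (τ - ℓ z) 0
    have e5 : 0 ≤ γ * ‖T z - z‖ ^ 2 := by positivity
    dsimp only
    rw [e]
    rcases max_cases (ℓ (T z) - τ) 0 with ⟨hm, -⟩ | ⟨hm, -⟩ <;> rw [hm] <;> linarith
  have i34 : Integrable (fun z => ℓ (T' z) - γ * ‖T' z - z‖ ^ 2) P₀ := i3.sub i4
  have i345 : Integrable (fun z => ℓ (T' z) - γ * ‖T' z - z‖ ^ 2 + max (τ - ℓ z) 0) P₀ :=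
    i34.add i5
  rw [integral_sub i1 i2, integral_sub i345 (integrable_const τ), integral_add i34 i5,
    integral_sub i3 i4, integral_const_mul, integral_const_mul,
    integral_const, probReal_univ, one_smul] at key
  simp only [lagrangian] at hlt
  linarith

theorem exists_memAmbiguity_of_eq_one [IsProbabilityMeasure P₀] (h0 : MemLp id 2 P₀)
    (hℓ : Measurable ℓ) (hr : 0 < r)
    (hcomp : ∀ T : E → E, Measurable T → MemLp T 2 P₀ → Integrable (fun z => ℓ (T z)) P₀)
    {c : ℝ} (hc : ∀ γ : ℝ, 0 ≤ γ → ∃ T : E → E, Measurable T ∧ MemLp T 2 P₀ ∧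
      c < ∫ z, ℓ (T z) ∂P₀ + γ * (r ^ 2 - ∫ z, ‖T z - z‖ ^ 2 ∂P₀)) :
    ∃ P, MemAmbiguity P₀ r P ∧ (c : EReal) ≤ CVaR 1 P ℓ := by
  let ι := {T : E → E // Measurable T ∧ MemLp T 2 P₀}
  let f : ι → ℝ → ℝ := fun T γ =>
    ∫ z, ℓ (T.1 z) ∂P₀ + γ * (r ^ 2 - ∫ z, ‖T.1 z - z‖ ^ 2 ∂P₀)
  have hr2 : 0 < r ^ 2 := by positivity
  obtain ⟨s, w, hw, hw1, hsum⟩ := exists_weights_le_sum_of_isCompact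
    (S := Set.Ici (0 : ℝ)) (K := Set.Icc 0 ((c - ∫ z, ℓ z ∂P₀) / r ^ 2)) (f := f)
    ⟨0, by simp⟩ isCompact_Icc
    (fun T => ⟨convex_Ici 0, fun x _ y _ a b _ _ hab => by
      obtain rfl : b = 1 - a := by linarith
      refine le_of_eq ?_
      simp only [f, smul_eq_mul]
      ring⟩)
    (fun T => by simp only [f]; fun_prop) (c := c) ⟨id, measurable_id, h0⟩
    (fun γ hγ hK => by
      have hlt : (c - ∫ z, ℓ z ∂P₀) / r ^ 2 < γ := by
        by_contra! hle
        exact hK ⟨hγ, hle⟩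
      rw [div_lt_iff₀ hr2] at hlt
      simp only [f, id, sub_self, norm_zero]
      simp only [ne_eq, OfNat.ofNat_ne_zero, not_false_eq_true, zero_pow, integral_zero, sub_zero]
      linarith)
    (fun γ hγ => by
      obtain ⟨T, hT, hT2, hlt⟩ := hc γ hγ.1
      exact ⟨⟨T, hT, hT2⟩, hlt⟩)
  let P := mixtureMap P₀ s w fun T : ι => T.1
  have hT : ∀ T ∈ s, Measurable (T : ι).1 := fun T _ => T.2.1
  let D := r ^ 2 - ∑ T ∈ s, w T * ∫ z, ‖T.1 z - z‖ ^ 2 ∂P₀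
  have hval : ∀ γ : ℝ, 0 ≤ γ → c ≤ ∫ z, ℓ z ∂P + γ * D := by
    intro γ hγ
    refine (hsum γ hγ).trans (le_of_eq ?_)
    rw [integral_mixtureMap hT hw hℓ fun T _ => hcomp T.1 T.2.1 T.2.2]
    have e : ∀ T ∈ s, w T * f T γ = w T * ∫ z, ℓ (T.1 z) ∂P₀ + γ * (w T * r ^ 2) -
        γ * (w T * ∫ z, ‖T.1 z - z‖ ^ 2 ∂P₀) := fun T _ => by
      simp only [f]
      ring
    rw [Finset.sum_congr rfl e, Finset.sum_sub_distrib, Finset.sum_add_distrib,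
      ← Finset.mul_sum, ← Finset.mul_sum, ← Finset.sum_mul, hw1]
    simp only [D]
    ring
  have hD : 0 ≤ D := nonneg_of_forall_le_add_mul hval
  have hmem : MemAmbiguity P₀ r P := memAmbiguity_mixtureMap h0 hT (fun T _ => T.2.2) hw hw1
    (by simp only [D] at hD; linarith)
  have := hmem.1
  have hℓP : Integrable ℓ P :=
    integrable_mixtureMap hT hℓ fun T _ => hcomp T.1 T.2.1 T.2.2
  refine ⟨P, hmem, coe_le_CVaR hℓP fun τ => ?_⟩
  have h1 : c ≤ ∫ z, ℓ z ∂P := by simpa using hval 0 le_rfl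
  have h2 : ∫ z, (ℓ z - τ) ∂P ≤ ∫ z, max (ℓ z - τ) 0 ∂P :=
    integral_mono (hℓP.sub (integrable_const τ)) (integrable_max_sub hℓP τ)
      fun z => le_max_left _ _
  rw [integral_sub hℓP (integrable_const τ), integral_const, probReal_univ, one_smul] at h2
  linarith

end Duality

/-- **Theorem 1 (Strong duality for worst-case CVaR).**
Let `r > 0` and `α ∈ (0,1]`. If `ℓ` is upper semicontinuous,
`sup_{P ∈ 𝒫} E_P[(ℓ(z))₊] < ∞`, and `E_P[ℓ(z)] > -∞` for every `P ∈ 𝒫`, then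
`sup_{P∈𝒫} CVaR_P^α(ℓ(z)) = inf_{τ ∈ ℝ, γ ≥ 0} { τ + (1/α)(γ r² + E_{P₀}[φ(τ,γ,z)]) }`. -/
theorem strong_duality_worst_case_CVaR {d : ℕ} (r α : ℝ) (hr : 0 < r)
    (hα : α ∈ Set.Ioc (0 : ℝ) 1)
    (P₀ : Measure (EuclideanSpace ℝ (Fin d))) [IsProbabilityMeasure P₀]
    (hP₀ : Integrable (fun z => ‖z‖ ^ 2) P₀)
    (ℓ : EuclideanSpace ℝ (Fin d) → ℝ)
    (husc : UpperSemicontinuous ℓ)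
    (hsup : (⨆ (P : Measure (EuclideanSpace ℝ (Fin d))) (_ : MemAmbiguity P₀ r P),
        ∫⁻ z, ENNReal.ofReal (ℓ z) ∂P) < ⊤)
    (hlow : ∀ P : Measure (EuclideanSpace ℝ (Fin d)), MemAmbiguity P₀ r P →
        ∫⁻ z, ENNReal.ofReal (-(ℓ z)) ∂P < ⊤) :
    (⨆ (P : Measure (EuclideanSpace ℝ (Fin d))) (_ : MemAmbiguity P₀ r P), CVaR α P ℓ)
      = ⨅ (τ : ℝ) (γ : ℝ) (_ : 0 ≤ γ),
          (τ : EReal) + ((1 / α : ℝ) : EReal) *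
            ((ENNReal.ofReal (γ * r ^ 2) + ∫⁻ z, phi ℓ τ γ z ∂P₀ : ℝ≥0∞) : EReal) := by
  have hℓ : Measurable ℓ := husc.measurable
  have hα0 : 0 < α := hα.1
  have h0 : MemLp id 2 P₀ :=
    (memLp_two_iff_integrable_sq_norm measurable_id.aestronglyMeasurable).2 hP₀
  have hcomp : ∀ T : EuclideanSpace ℝ (Fin d) → EuclideanSpace ℝ (Fin d), Measurable T →
      MemLp T 2 P₀ → Integrable (fun z => ℓ (T z)) P₀ := fun T hT hT2 =>
    integrable_comp_of_memAmbiguity hr h0 hℓ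
      (fun P hP => (le_iSup₂ (f := fun P (_ : MemAmbiguity P₀ r P) =>
        ∫⁻ z, ENNReal.ofReal (ℓ z) ∂P) P hP).trans_lt hsup) hlow hT hT2
  refine le_antisymm ?_ ?_
  · refine iSup₂_le fun P hP => le_iInf fun τ => le_iInf₂ fun γ hγ => ?_
    refine (iInf_le _ τ).trans (add_le_add le_rfl (mul_le_mul_of_nonneg_left ?_
      (EReal.coe_nonneg.2 (one_div_pos.2 hα0).le)))
    exact EReal.coe_ennreal_le_coe_ennreal_iff.2 (lintegral_le_add_lintegral_phi hℓ hP τ hγ)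
  · refine le_of_forall_lt fun b hb => ?_
    obtain ⟨c, hbc, hc⟩ := EReal.lt_iff_exists_real_btwn.1 hb
    refine hbc.trans_le ?_
    obtain ⟨c', hcc, hc'⟩ := EReal.lt_iff_exists_real_btwn.1 hc
    have hlag : ∀ τ γ : ℝ, 0 ≤ γ → ∃ T : EuclideanSpace ℝ (Fin d) → EuclideanSpace ℝ (Fin d),
        Measurable T ∧ MemLp T 2 P₀ ∧ c' < lagrangian P₀ ℓ r α T (τ, γ) := fun τ γ hγ =>
      exists_lt_lagrangian h0 hℓ hα0 hcomp hγ
        (hc'.trans_le ((iInf_le _ τ).trans (iInf₂_le γ hγ)))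
    have hcc' : c < c' := EReal.coe_lt_coe_iff.1 hcc
    obtain ⟨P, hP, hle⟩ : ∃ P, MemAmbiguity P₀ r P ∧ (c : EReal) ≤ CVaR α P ℓ := by
      rcases hα.2.lt_or_eq with hα1 | rfl
      · obtain ⟨P, hP, hle⟩ := exists_memAmbiguity_of_lt_one h0 hℓ hr hα0 hα1 hcomp hlag
        exact ⟨P, hP, hcc.le.trans hle⟩
      · exact exists_memAmbiguity_of_eq_one h0 hℓ hr hcomp fun γ hγ =>
          exists_lt_integral_add_of_lagrangian h0 hℓ hcomp hcc' hγ fun τ => hlag τ γ hγ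
    exact hle.trans (le_iSup₂ (f := fun P (_ : MemAmbiguity P₀ r P) => CVaR α P ℓ) P hP)

end
end

section
/- Let r > 0, α ∈ (0,1], Q ∈ 𝕊^d a symmetric matrix, q ∈ ℝ^d, and P₀ ∈ 𝓜(ℝ^d). Then the worst-case CVaR value sup_{P∈𝒫} CVaR_P^α( zᵀQz + 2qᵀz ) is finite, and it equals the optimal value of the convex program inf_{γ∈Γ} CVaR_{P₀}^α( (γz+q)ᵀ Q_γ^{-1} (γz+q) + γ( r²/α − ‖z‖² ) ), where Q_γ := γI − Q and Γ := {γ ≥ 0 : Q_γ ≻ 0}. -/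
open MeasureTheory RealInnerProductSpace ENNReal

noncomputable section

open scoped Pointwise in
/-- Lagrange multipliers for a linear programme over a convex set with two inequality constraints,
the origin being a Slater point. -/
theorem exists_lagrange_multipliers {S : Set (ℝ × ℝ × ℝ)} (hS : Convex ℝ S) (h0 : 0 ∈ S)
    {t α ρ : ℝ} (hα : 0 < α) (hρ : 0 < ρ)
    (h : ∀ p ∈ S, p.2.1 ≤ α → p.2.2 ≤ ρ → p.1 ≤ t) :
    ∃ τ γ : ℝ, 0 ≤ τ ∧ 0 ≤ γ ∧ ∀ p ∈ S, p.1 + τ * (α - p.2.1) + γ * (ρ - p.2.2) ≤ t := by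
  set C : Set (ℝ × ℝ × ℝ) := Set.Iio 0 ×ˢ (Set.Ioi 0 ×ˢ Set.Ioi 0) with hC
  have hCconv : Convex ℝ C := (convex_Iio 0).prod ((convex_Ioi 0).prod (convex_Ioi 0))
  have hCopen : IsOpen C := isOpen_Iio.prod (isOpen_Ioi.prod isOpen_Ioi)
  have hnot : (t, α, ρ) ∉ S + C := by
    rintro ⟨p, hp, c, ⟨hc1, hc2, hc3⟩, hpc⟩
    simp only [Prod.ext_iff, Prod.fst_add, Prod.snd_add] at hpc
    simp only [Set.mem_Iio, Set.mem_Ioi] at hc1 hc2 hc3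
    have := h p hp (by linarith) (by linarith)
    linarith
  obtain ⟨f, hf⟩ := geometric_hahn_banach_open_point (hS.add hCconv) hCopen.add_left hnot
  set u := f (1, 0, 0) with hu
  set v := f (0, 1, 0) with hv
  set w := f (0, 0, 1) with hw
  have hfe : ∀ a b c : ℝ, f (a, b, c) = a * u + b * v + c * w := by
    intro a b c
    have : ((a, b, c) : ℝ × ℝ × ℝ) = a • (1, 0, 0) + b • (0, 1, 0) + c • (0, 0, 1) := by simp
    rw [this, map_add, map_add, map_smul, map_smul, map_smul]; simp [hu, hv, hw]
  have key : ∀ p ∈ S, ∀ x y z : ℝ, 0 < x → 0 < y → 0 < z →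
      (p.1 - x) * u + (p.2.1 + y) * v + (p.2.2 + z) * w < t * u + α * v + ρ * w := by
    intro p hp x y z hx hy hz
    have := hf (p + (-x, y, z)) (Set.add_mem_add hp ⟨by simpa using hx, by simpa using hy,
      by simpa using hz⟩)
    rw [hfe] at this
    have e : p + (-x, y, z) = (p.1 - x, p.2.1 + y, p.2.2 + z) := by
      ext <;> simp [sub_eq_add_neg]
    rwa [e, hfe] at this
  have lim : ∀ A B : ℝ, (∀ x : ℝ, 0 < x → x * A < B) → A ≤ 0 := by
    intro A B hAB
    by_contra hA
    push Not at hA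
    have := hAB ((|B| + 1) / A) (by positivity)
    rw [div_mul_cancel₀ _ hA.ne'] at this
    linarith [le_abs_self B]
  have hu0 : 0 ≤ u := by
    have := lim (-u) (t * u + α * v + ρ * w - v - w) fun x hx => by
      have := key 0 h0 x 1 1 hx one_pos one_pos
      simp at this; linarith
    linarith
  have hv0 : v ≤ 0 := lim v (t * u + α * v + ρ * w + u - w) fun x hx => by
      have := key 0 h0 1 x 1 one_pos hx one_pos
      simp at this; linarith
  have hw0 : w ≤ 0 := lim w (t * u + α * v + ρ * w + u - v) fun x hx => by
      have := key 0 h0 1 1 x one_pos one_pos hx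
      simp at this; linarith
  have hupos : 0 < u := by
    rcases hu0.lt_or_eq with h1 | h1
    · exact h1
    · have := key 0 h0 1 (α / 2) (ρ / 2) one_pos (by positivity) (by positivity)
      rw [← h1] at this
      simp at this
      nlinarith
  have key' : ∀ p ∈ S, p.1 * u + p.2.1 * v + p.2.2 * w ≤ t * u + α * v + ρ * w := by
    intro p hp
    refine le_of_forall_pos_lt_add fun ε hε => ?_
    have hs : 0 < u - v - w + 1 := by linarith
    have := key p hp (ε / (u - v - w + 1)) (ε / (u - v - w + 1)) (ε / (u - v - w + 1))
      (by positivity) (by positivity) (by positivity)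
    have e : ε / (u - v - w + 1) * (u - v - w + 1) = ε := div_mul_cancel₀ _ hs.ne'
    have : 0 < ε / (u - v - w + 1) := by positivity
    nlinarith
  refine ⟨-v / u, -w / u, div_nonneg (by linarith) hu0, div_nonneg (by linarith) hu0,
    fun p hp => ?_⟩
  have e : t - (p.1 + -v / u * (α - p.2.1) + -w / u * (ρ - p.2.2)) =
      (t * u + α * v + ρ * w - (p.1 * u + p.2.1 * v + p.2.2 * w)) / u := by
    field_simp; ring
  have : 0 ≤ (t * u + α * v + ρ * w - (p.1 * u + p.2.1 * v + p.2.2 * w)) / u :=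
    div_nonneg (by linarith [key' p hp]) hu0
  linarith

section Transport

variable {E : Type*} [NormedAddCommGroup E] [MeasurableSpace E]

/-- Weak duality between the worst case over the ambiguity ball and a penalised loss. -/
theorem CVaR_le_of_penalized [BorelSpace E] [SecondCountableTopology E]
    {P₀ P : Measure E} {r α γ : ℝ} {ℓ g : E → ℝ} (hα : 0 < α) (hγ : 0 ≤ γ)
    (hP : MemAmbiguity P₀ r P) (hℓ : Measurable ℓ) (hg : Measurable g)
    (h : ∀ x z, ℓ x - γ * ‖x - z‖ ^ 2 ≤ g z) :
    CVaR α P ℓ ≤ CVaR α P₀ (fun z => g z + γ * (r ^ 2 / α)) := by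
  refine le_iInf fun τ => ?_
  set τ₀ := τ - γ * (r ^ 2 / α) with hτ₀
  set L : ℝ≥0∞ := ∫⁻ z, ENNReal.ofReal (g z + γ * (r ^ 2 / α) - τ) ∂P₀ with hL
  have hLe : L = ∫⁻ z, ENNReal.ofReal (g z - τ₀) ∂P₀ :=
    lintegral_congr fun z => by congr 1; rw [hτ₀]; ring
  have hcoup : ∀ π : Measure (E × E), IsCoupling π P P₀ →
      ∫⁻ z, ENNReal.ofReal (ℓ z - τ₀) ∂P ≤
        L + ENNReal.ofReal γ * ∫⁻ p, ENNReal.ofReal (‖p.1 - p.2‖ ^ 2) ∂π := by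
    rintro π ⟨-, h1, h2⟩
    rw [hLe, ← h1, ← h2, lintegral_map (by fun_prop) measurable_fst,
      lintegral_map (by fun_prop) measurable_snd,
      ← lintegral_const_mul _ (by fun_prop), ← lintegral_add_left (by fun_prop)]
    refine lintegral_mono fun p => ?_
    rw [← ENNReal.ofReal_mul hγ]
    refine le_trans (ENNReal.ofReal_le_ofReal ?_) ENNReal.ofReal_add_le
    linarith [h p.1 p.2]
  have hball : ∫⁻ z, ENNReal.ofReal (ℓ z - τ₀) ∂P ≤ L + ENNReal.ofReal (γ * r ^ 2) := by
    refine ENNReal.le_of_forall_pos_le_add fun ε hε _ => ?_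
    have hlt : W2sq P P₀ < ENNReal.ofReal (r ^ 2) + ε / (ENNReal.ofReal γ + 1) :=
      hP.2.2.trans_lt (ENNReal.lt_add_right ENNReal.ofReal_ne_top
        (ENNReal.div_pos (by exact_mod_cast hε.ne') (by simp)).ne')
    obtain ⟨π, hπ⟩ := iInf_lt_iff.1 hlt
    obtain ⟨hπc, hπ⟩ := iInf_lt_iff.1 hπ
    refine (hcoup π hπc).trans ?_
    rw [ENNReal.ofReal_mul hγ, add_assoc]
    gcongr
    refine (mul_le_mul_right hπ.le _).trans ?_
    rw [mul_add]
    gcongr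
    calc ENNReal.ofReal γ * (ε / (ENNReal.ofReal γ + 1))
        ≤ (ENNReal.ofReal γ + 1) * (ε / (ENNReal.ofReal γ + 1)) := by gcongr; exact le_self_add
      _ ≤ ε := ENNReal.mul_div_le
  refine (iInf_le _ τ₀).trans ?_
  have hα' : 0 < 1 / α := by positivity
  rcases eq_or_ne L ⊤ with hT | hT
  · rw [hT, EReal.coe_ennreal_top, EReal.coe_mul_top_of_pos hα', EReal.coe_add_top]
    exact le_top
  · lift L to NNReal using hT with L'
    have hb : ((∫⁻ z, ENNReal.ofReal (ℓ z - τ₀) ∂P : ℝ≥0∞) : EReal)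
        ≤ (((L' : ℝ) + γ * r ^ 2 : ℝ) : EReal) := by
      refine (EReal.coe_ennreal_le_coe_ennreal_iff.2 hball).trans_eq ?_
      rw [EReal.coe_ennreal_add, EReal.coe_ennreal_ofReal, max_eq_left (by positivity)]
      rfl
    have hc : ((1 / α : ℝ) : EReal) * ((∫⁻ z, ENNReal.ofReal (ℓ z - τ₀) ∂P : ℝ≥0∞) : EReal)
        ≤ ((1 / α : ℝ) : EReal) * (((L' : ℝ) + γ * r ^ 2 : ℝ) : EReal) :=
      mul_le_mul_of_nonneg_left hb (by exact_mod_cast hα'.le)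
    refine (add_le_add_right hc _).trans ?_
    have : (((L' : ℝ≥0∞)) : EReal) = ((L' : ℝ) : EReal) := rfl
    rw [this]
    norm_cast
    rw [hτ₀]
    apply le_of_eq
    field_simp
    ring

/-- `μ` transports a sub-measure of `P₀` (its second marginal) at finite quadratic cost. -/
def IsPartialTransport (P₀ : Measure E) (μ : Measure (E × E)) : Prop :=
  μ.map Prod.snd ≤ P₀ ∧ Integrable (fun p : E × E => ‖p.1 - p.2‖ ^ 2) μ

theorem IsPartialTransport.isFiniteMeasure {P₀ : Measure E} [IsFiniteMeasure P₀]
    {μ : Measure (E × E)} (h : IsPartialTransport P₀ μ) : IsFiniteMeasure μ := by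
  refine ⟨?_⟩
  have : μ Set.univ = μ.map Prod.snd Set.univ := by
    rw [Measure.map_apply measurable_snd MeasurableSet.univ, Set.preimage_univ]
  rw [this]
  exact (h.1 _).trans_lt (measure_lt_top _ _)

theorem integrable_of_abs_le_one_add_sq {P : Measure E} [IsFiniteMeasure P]
    (hP : Integrable (fun z => ‖z‖ ^ 2) P) {f : E → ℝ} (hf : Measurable f) {A : ℝ}
    (hA : ∀ z, |f z| ≤ A * (1 + ‖z‖ ^ 2)) : Integrable f P :=
  (((integrable_const 1).add hP).const_mul A).mono' hf.aestronglyMeasurable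
    (Filter.Eventually.of_forall hA)

theorem isPartialTransport_zero (P₀ : Measure E) : IsPartialTransport P₀ 0 := by
  simp [IsPartialTransport, Measure.zero_le]

theorem IsPartialTransport.combo {P₀ : Measure E} {μ ν : Measure (E × E)}
    (hμ : IsPartialTransport P₀ μ) (hν : IsPartialTransport P₀ ν) {a b : NNReal} (hab : a + b = 1) :
    IsPartialTransport P₀ (a • μ + b • ν) := by
  constructor
  · rw [Measure.map_add _ _ measurable_snd, Measure.map_smul, Measure.map_smul]
    calc a • μ.map Prod.snd + b • ν.map Prod.snd ≤ a • P₀ + b • P₀ := by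
          gcongr
          · exact hμ.1
          · exact hν.1
      _ = P₀ := by rw [← add_smul, hab, one_smul]
  · exact (hμ.2.smul_measure_nnreal).add_measure (hν.2.smul_measure_nnreal)

theorem ofReal_integral_le_lintegral_ofReal {X : Type*} [MeasurableSpace X] {μ : Measure X}
    {f : X → ℝ} (hf : Integrable f μ) :
    ENNReal.ofReal (∫ x, f x ∂μ) ≤ ∫⁻ x, ENNReal.ofReal (f x) ∂μ := by
  calc ENNReal.ofReal (∫ x, f x ∂μ) ≤ ENNReal.ofReal (∫ x, max (f x) 0 ∂μ) :=
        ENNReal.ofReal_le_ofReal (integral_mono hf hf.pos_part fun x => le_max_left _ _)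
    _ = ∫⁻ x, ENNReal.ofReal (max (f x) 0) ∂μ :=
        ofReal_integral_eq_lintegral_ofReal hf.pos_part
          (Filter.Eventually.of_forall fun x => le_max_right _ _)
    _ = ∫⁻ x, ENNReal.ofReal (f x) ∂μ := by simp

theorem coe_le_add_mul_coe_ennreal {c X τ : ℝ} {L : ℝ≥0∞} (hc : 0 ≤ c)
    (h : ENNReal.ofReal X ≤ L) :
    ((τ + c * X : ℝ) : EReal) ≤ (τ : EReal) + (c : EReal) * (L : EReal) := by
  have h1 : (X : EReal) ≤ (L : EReal) := by
    refine le_trans ?_ (EReal.coe_ennreal_le_coe_ennreal_iff.2 h)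
    rw [EReal.coe_ennreal_ofReal]
    exact_mod_cast le_max_left _ _
  have h2 : (c : EReal) * X ≤ (c : EReal) * L :=
    mul_le_mul_of_nonneg_left h1 (by exact_mod_cast hc)
  rw [EReal.coe_add, EReal.coe_mul]
  exact add_le_add_right h2 _

variable [BorelSpace E] [SecondCountableTopology E]

theorem IsPartialTransport.integrable_sq_fst {P₀ : Measure E} [IsFiniteMeasure P₀]
    (hP₀ : Integrable (fun z => ‖z‖ ^ 2) P₀)
    {μ : Measure (E × E)} (h : IsPartialTransport P₀ μ) :
    Integrable (fun z => ‖z‖ ^ 2) (μ.map Prod.fst) := by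
  rw [integrable_map_measure (by fun_prop) (by fun_prop)]
  have h2 : Integrable (fun p : E × E => ‖p.2‖ ^ 2) μ :=
    (hP₀.mono_measure h.1).comp_measurable measurable_snd
  refine ((h.2.const_mul 2).add (h2.const_mul 2)).mono' (by fun_prop)
    (Filter.Eventually.of_forall fun p => ?_)
  simp only [Function.comp_apply, Pi.add_apply, norm_pow, norm_norm]
  have h3 : ‖p.1‖ ≤ ‖p.1 - p.2‖ + ‖p.2‖ := by simpa using norm_add_le (p.1 - p.2) p.2
  nlinarith [sq_nonneg (‖p.1 - p.2‖ - ‖p.2‖), norm_nonneg p.1]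

theorem IsPartialTransport.integrable_fst {P₀ : Measure E} [IsFiniteMeasure P₀]
    (hP₀ : Integrable (fun z => ‖z‖ ^ 2) P₀)
    {μ : Measure (E × E)} (h : IsPartialTransport P₀ μ) {f : E → ℝ} (hf : Measurable f) {A : ℝ}
    (hA : ∀ z, |f z| ≤ A * (1 + ‖z‖ ^ 2)) : Integrable (fun p => f p.1) μ := by
  have := h.isFiniteMeasure
  exact (integrable_of_abs_le_one_add_sq (h.integrable_sq_fst hP₀) hf hA).comp_measurable
    measurable_fst

theorem isPartialTransport_map {P₀ ν : Measure E} (hν : ν ≤ P₀) {T : E → E} (hT : Measurable T)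
    (hcost : Integrable (fun z => ‖T z - z‖ ^ 2) P₀) :
    IsPartialTransport P₀ (ν.map fun z => (T z, z)) := by
  constructor
  · rw [Measure.map_map measurable_snd (by fun_prop)]
    exact (Measure.map_id (μ := ν)).trans_le hν
  · rw [integrable_map_measure (by fun_prop) (by fun_prop)]
    exact hcost.mono_measure hν

/-- Completing a partial transport by leaving the remaining mass in place yields a measure in the
ambiguity ball whose CVaR is controlled from below. -/
theorem IsPartialTransport.exists_memAmbiguity_le_CVaR {P₀ : Measure E} [IsProbabilityMeasure P₀]
    (hP₀ : Integrable (fun z => ‖z‖ ^ 2) P₀) {μ : Measure (E × E)} (h : IsPartialTransport P₀ μ)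
    {ℓ : E → ℝ} (hℓ : Measurable ℓ) {A : ℝ} (hA : ∀ z, |ℓ z| ≤ A * (1 + ‖z‖ ^ 2))
    {α r : ℝ} (hα : 0 < α) (hα1 : α ≤ 1) (hm : μ.real Set.univ ≤ α)
    (hc : ∫ p, ‖p.1 - p.2‖ ^ 2 ∂μ ≤ r ^ 2) (M : ℝ) :
    ∃ P, MemAmbiguity P₀ r P ∧
      (((∫ p, (ℓ p.1 + M) ∂μ - ∫ z, max (-ℓ z - M) 0 ∂P₀) / α - M : ℝ) : EReal)
        ≤ CVaR α P ℓ := by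
  have hfin := h.isFiniteMeasure
  set κ := P₀ - μ.map Prod.snd with hκ
  have hκadd : κ + μ.map Prod.snd = P₀ := Measure.sub_add_cancel_of_le h.1
  have hκle : κ ≤ P₀ := Measure.sub_le
  have hκfin : IsFiniteMeasure κ := isFiniteMeasure_of_le P₀ hκle
  have hmass : κ.real Set.univ + μ.real Set.univ = 1 := by
    have h1 : (κ + μ.map Prod.snd).real Set.univ = 1 := by rw [hκadd]; simp
    rw [measureReal_add_apply, map_measureReal_apply measurable_snd MeasurableSet.univ] at h1
    simpa using h1
  set π : Measure (E × E) := μ + κ.map (fun z => (z, z)) with hπ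
  have hfst : π.map Prod.fst = μ.map Prod.fst + κ := by
    rw [hπ, Measure.map_add _ _ measurable_fst, Measure.map_map measurable_fst (by fun_prop)]
    congr 1
    exact Measure.map_id
  have hsnd : π.map Prod.snd = P₀ := by
    rw [hπ, Measure.map_add _ _ measurable_snd, Measure.map_map measurable_snd (by fun_prop),
      ← hκadd, add_comm]
    congr 1
    exact Measure.map_id
  have hπprob : IsProbabilityMeasure π := by
    refine ⟨?_⟩
    have h1 := congrArg (fun ν : Measure E => ν Set.univ) hsnd
    simpa [Measure.map_apply measurable_snd MeasurableSet.univ] using h1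
  have hPprob : IsProbabilityMeasure (μ.map Prod.fst + κ) := by
    rw [← hfst]
    exact Measure.isProbabilityMeasure_map measurable_fst.aemeasurable
  have hℓκ : Integrable ℓ κ :=
    (integrable_of_abs_le_one_add_sq hP₀ hℓ hA).mono_measure hκle
  have hℓμ : Integrable (fun p => ℓ p.1) μ := h.integrable_fst hP₀ hℓ hA
  have hneg : Integrable (fun z => max (-ℓ z - M) 0) P₀ :=
    ((integrable_of_abs_le_one_add_sq hP₀ hℓ hA).neg.sub (integrable_const M)).pos_part
  have hδ : ∫ z, max (-ℓ z - M) 0 ∂κ ≤ ∫ z, max (-ℓ z - M) 0 ∂P₀ :=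
    integral_mono_measure hκle (Filter.Eventually.of_forall fun z => le_max_right _ _) hneg
  have hδ0 : 0 ≤ ∫ z, max (-ℓ z - M) 0 ∂P₀ := integral_nonneg fun z => le_max_right _ _
  refine ⟨μ.map Prod.fst + κ, ⟨hPprob, ?_, ?_⟩, ?_⟩
  · exact (h.integrable_sq_fst hP₀).add_measure (hP₀.mono_measure hκle)
  · refine (iInf₂_le π ⟨hπprob, hfst, hsnd⟩).trans ?_
    rw [hπ, lintegral_add_measure, lintegral_map (by fun_prop) (by fun_prop)]
    simp only [sub_self, norm_zero, ne_eq, OfNat.ofNat_ne_zero, not_false_eq_true, zero_pow,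
      ENNReal.ofReal_zero, lintegral_zero, add_zero]
    rw [← ofReal_integral_eq_lintegral_ofReal h.2
      (Filter.Eventually.of_forall fun p => by positivity)]
    exact ENNReal.ofReal_le_ofReal hc
  · refine le_iInf fun τ => ?_
    have hα' : 0 ≤ 1 / α := by positivity
    have hX1 := ofReal_integral_le_lintegral_ofReal (hℓμ.sub (integrable_const τ))
    simp only [Pi.sub_apply] at hX1
    have hI1 : ∫ p, (ℓ p.1 - τ) ∂μ = ∫ p, (ℓ p.1 + M) ∂μ - (τ + M) * μ.real Set.univ := by
      rw [integral_sub hℓμ (integrable_const τ), integral_add hℓμ (integrable_const M)]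
      simp; ring
    have hL : ∫⁻ z, ENNReal.ofReal (ℓ z - τ) ∂(μ.map Prod.fst + κ) =
        ∫⁻ p, ENNReal.ofReal (ℓ p.1 - τ) ∂μ + ∫⁻ z, ENNReal.ofReal (ℓ z - τ) ∂κ := by
      rw [lintegral_add_measure, lintegral_map (by fun_prop) measurable_fst]
    set I := ∫ p, (ℓ p.1 + M) ∂μ
    set m := μ.real Set.univ
    set δ := ∫ z, max (-ℓ z - M) 0 ∂P₀
    rcases le_or_gt (-M) τ with hτ | hτ
    · refine le_trans ?_ (coe_le_add_mul_coe_ennreal hα'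
        (hX1.trans (hL ▸ le_self_add)))
      rw [hI1, EReal.coe_le_coe_iff]
      have e : τ + 1 / α * (I - (τ + M) * m) - ((I - δ) / α - M) =
          (δ + (τ + M) * (α - m)) / α := by field_simp; ring
      have : 0 ≤ (δ + (τ + M) * (α - m)) / α :=
        div_nonneg (add_nonneg hδ0 (mul_nonneg (by linarith) (by linarith))) hα.le
      linarith
    · have hnegκ := hneg.mono_measure hκle
      have hX2 : ENNReal.ofReal (∫ z, ((-M - τ) - max (-ℓ z - M) 0) ∂κ) ≤
          ∫⁻ z, ENNReal.ofReal (ℓ z - τ) ∂κ := by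
        refine (ofReal_integral_le_lintegral_ofReal ((integrable_const _).sub hnegκ)).trans
          (lintegral_mono fun z => ENNReal.ofReal_le_ofReal ?_)
        simp only [Pi.sub_apply]
        linarith [le_max_left (-ℓ z - M) 0]
      have hI2 : ∫ z, ((-M - τ) - max (-ℓ z - M) 0) ∂κ =
          (-M - τ) * (1 - m) - ∫ z, max (-ℓ z - M) 0 ∂κ := by
        rw [integral_sub (integrable_const _) hnegκ]
        simp only [integral_const, smul_eq_mul]
        rw [← hmass]; ring
      refine le_trans ?_ (coe_le_add_mul_coe_ennreal hα'
        (ENNReal.ofReal_add_le.trans ((add_le_add hX1 hX2).trans hL.ge)))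
      rw [hI1, hI2, EReal.coe_le_coe_iff]
      set δ' := ∫ z, max (-ℓ z - M) 0 ∂κ
      have e : τ + 1 / α * (I - (τ + M) * m + ((-M - τ) * (1 - m) - δ')) - ((I - δ) / α - M) =
          ((δ - δ') + (-M - τ) * (1 - α)) / α := by field_simp; ring
      have : 0 ≤ ((δ - δ') + (-M - τ) * (1 - α)) / α :=
        div_nonneg (add_nonneg (by linarith) (mul_nonneg (by linarith) (by linarith))) hα.le
      linarith

/-- Lagrangian duality for partial transports of mass at most `α` and cost at most `ρ`. -/
theorem exists_multipliers_of_partialTransport_le {P₀ : Measure E} [IsFiniteMeasure P₀]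
    (hP₀ : Integrable (fun z => ‖z‖ ^ 2) P₀)
    {ℓ : E → ℝ} (hℓ : Measurable ℓ) {A : ℝ} (hA : ∀ z, |ℓ z| ≤ A * (1 + ‖z‖ ^ 2))
    {α ρ M t : ℝ} (hα : 0 < α) (hρ : 0 < ρ)
    (h : ∀ μ, IsPartialTransport P₀ μ → μ.real Set.univ ≤ α → ∫ p, ‖p.1 - p.2‖ ^ 2 ∂μ ≤ ρ →
      ∫ p, (ℓ p.1 + M) ∂μ ≤ t) :
    ∃ τ γ : ℝ, 0 ≤ τ ∧ 0 ≤ γ ∧ ∀ μ, IsPartialTransport P₀ μ →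
      ∫ p, (ℓ p.1 + M) ∂μ + τ * (α - μ.real Set.univ)
        + γ * (ρ - ∫ p, ‖p.1 - p.2‖ ^ 2 ∂μ) ≤ t := by
  set F : Measure (E × E) → ℝ × ℝ × ℝ := fun μ =>
    (∫ p, (ℓ p.1 + M) ∂μ, μ.real Set.univ, ∫ p, ‖p.1 - p.2‖ ^ 2 ∂μ) with hF
  have hconv : Convex ℝ (F '' {μ | IsPartialTransport P₀ μ}) := by
    rintro _ ⟨μ, hμ, rfl⟩ _ ⟨ν, hν, rfl⟩ a b ha hb hab
    lift a to NNReal using ha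
    lift b to NNReal using hb
    refine ⟨a • μ + b • ν, IsPartialTransport.combo hμ hν (by exact_mod_cast hab), ?_⟩
    have hμf := IsPartialTransport.isFiniteMeasure hμ
    have hνf := IsPartialTransport.isFiniteMeasure hν
    have hiμ := (IsPartialTransport.integrable_fst hP₀ hμ hℓ hA).add (integrable_const M)
    have hiν := (IsPartialTransport.integrable_fst hP₀ hν hℓ hA).add (integrable_const M)
    simp only [hF, Prod.smul_mk, Prod.mk_add_mk, Prod.mk.injEq]
    refine ⟨?_, ?_, ?_⟩
    · rw [integral_add_measure (f := fun p : E × E => ℓ p.1 + M) hiμ.smul_measure_nnreal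
        hiν.smul_measure_nnreal, integral_smul_nnreal_measure, integral_smul_nnreal_measure]
      rfl
    · rw [measureReal_add_apply, measureReal_nnreal_smul_apply, measureReal_nnreal_smul_apply]
      rfl
    · rw [integral_add_measure hμ.2.smul_measure_nnreal
        hν.2.smul_measure_nnreal, integral_smul_nnreal_measure, integral_smul_nnreal_measure]
      rfl
  obtain ⟨τ, γ, hτ, hγ, H⟩ := exists_lagrange_multipliers hconv
    ⟨0, isPartialTransport_zero P₀, by simp [hF]⟩ hα hρ (t := t) (by
      rintro _ ⟨μ, hμ, rfl⟩ h1 h2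
      exact h μ hμ h1 h2)
  exact ⟨τ, γ, hτ, hγ, fun μ hμ => H _ ⟨μ, hμ, rfl⟩⟩

theorem integrable_comp_of_integrable_cost {P₀ : Measure E} [IsFiniteMeasure P₀]
    (hP₀ : Integrable (fun z => ‖z‖ ^ 2) P₀)
    {ℓ : E → ℝ} (hℓ : Measurable ℓ) {A : ℝ} (hA : ∀ z, |ℓ z| ≤ A * (1 + ‖z‖ ^ 2))
    {T : E → E} (hT : Measurable T) (hcost : Integrable (fun z => ‖T z - z‖ ^ 2) P₀) :
    Integrable (fun z => ℓ (T z)) P₀ := by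
  have h1 := (isPartialTransport_map le_rfl hT hcost).integrable_fst hP₀ hℓ hA
  have hm : AEStronglyMeasurable (fun p : E × E => ℓ p.1) (P₀.map fun z => (T z, z)) :=
    (hℓ.comp measurable_fst).aestronglyMeasurable
  rwa [integrable_map_measure hm (by fun_prop)] at h1

/-- A Lagrangian bound over all partial transports bounds the CVaR of the penalised loss. -/
theorem CVaR_le_of_lagrangian_le {P₀ : Measure E} [IsFiniteMeasure P₀]
    (hP₀ : Integrable (fun z => ‖z‖ ^ 2) P₀)
    {ℓ g : E → ℝ} (hℓ : Measurable ℓ) {A : ℝ} (hA : ∀ z, |ℓ z| ≤ A * (1 + ‖z‖ ^ 2))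
    {T : E → E} (hT : Measurable T) (hcost : Integrable (fun z => ‖T z - z‖ ^ 2) P₀)
    {α ρ M t τ γ : ℝ} (hα : 0 < α) (hg : ∀ z, ℓ (T z) - γ * ‖T z - z‖ ^ 2 = g z)
    (h : ∀ μ, IsPartialTransport P₀ μ → ∫ p, (ℓ p.1 + M) ∂μ + τ * (α - μ.real Set.univ)
        + γ * (ρ - ∫ p, ‖p.1 - p.2‖ ^ 2 ∂μ) ≤ t) :
    CVaR α P₀ (fun z => g z + γ * (ρ / α)) ≤ ((t / α - M : ℝ) : EReal) := by
  have hℓT := integrable_comp_of_integrable_cost hP₀ hℓ hA hT hcost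
  have hgm : Measurable g := by
    rw [← funext hg]; fun_prop
  have hgi : Integrable g P₀ := by
    rw [← funext hg]; exact hℓT.sub (hcost.const_mul γ)
  set s : Set E := {z | 0 ≤ g z + M - τ} with hs
  have hsm : MeasurableSet s := measurableSet_le measurable_const (by fun_prop)
  have hmap : AEMeasurable (fun z => (T z, z)) (P₀.restrict s) := by fun_prop
  have key := h _ (isPartialTransport_map (Measure.restrict_le_self (s := s)) hT hcost)
  have hmeas : AEStronglyMeasurable (fun p : E × E => ℓ p.1 + M)
      ((P₀.restrict s).map fun z => (T z, z)) :=
    ((hℓ.comp measurable_fst).add_const M).aestronglyMeasurable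
  rw [integral_map hmap hmeas,
    integral_map hmap (by fun_prop),
    map_measureReal_apply (by fun_prop) MeasurableSet.univ, Set.preimage_univ] at key
  have hint : Integrable (fun z => g z + M - τ) P₀ :=
    (hgi.add (integrable_const M)).sub (integrable_const τ)
  have hpos : ∫ z, max (g z + M - τ) 0 ∂P₀ = ∫ z in s, (ℓ (T z) + M) ∂P₀
      - τ * (P₀.restrict s).real Set.univ - γ * ∫ z in s, ‖T z - z‖ ^ 2 ∂P₀ := by
    have h1 : ∫ z, max (g z + M - τ) 0 ∂P₀ = ∫ z in s, (g z + M - τ) ∂P₀ := by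
      rw [← integral_indicator hsm]
      refine integral_congr_ae (Filter.Eventually.of_forall fun z => ?_)
      by_cases hz : z ∈ s
      · simp only [Set.indicator_of_mem hz]; exact max_eq_left hz
      · simp only [Set.indicator_of_notMem hz]; exact max_eq_right (not_le.1 hz).le
    have h2 : (fun z => g z + M - τ) = fun z => (ℓ (T z) + M - τ) - γ * ‖T z - z‖ ^ 2 := by
      funext z; rw [← hg]; ring
    have i1 : Integrable (fun z => ℓ (T z) + M) (P₀.restrict s) :=
      (hℓT.add (integrable_const M)).restrict
    rw [h1, h2, integral_sub (f := fun z => ℓ (T z) + M - τ) (i1.sub (integrable_const τ))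
      (hcost.const_mul γ).restrict,
      integral_sub i1 (integrable_const τ), integral_const_mul]
    simp [mul_comm]
  have hlin : ∫⁻ z, ENNReal.ofReal (g z + γ * (ρ / α) - (τ - M + γ * (ρ / α))) ∂P₀ =
      ENNReal.ofReal (∫ z, max (g z + M - τ) 0 ∂P₀) := by
    rw [ofReal_integral_eq_lintegral_ofReal hint.pos_part
      (Filter.Eventually.of_forall fun z => le_max_right _ _)]
    refine lintegral_congr fun z => ?_
    rw [ENNReal.ofReal_max, ENNReal.ofReal_zero, max_eq_left zero_le]
    congr 1; ring
  refine (iInf_le _ (τ - M + γ * (ρ / α))).trans ?_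
  rw [hlin, EReal.coe_ennreal_ofReal,
    max_eq_left (integral_nonneg (f := fun z => max (g z + M - τ) 0) fun z => le_max_right _ _)]
  norm_cast
  have e : t / α - M - (τ - M + γ * (ρ / α) + 1 / α * ∫ z, max (g z + M - τ) 0 ∂P₀) =
      (t - (τ * α + γ * ρ + ∫ z, max (g z + M - τ) 0 ∂P₀)) / α := by field_simp; ring
  have : 0 ≤ (t - (τ * α + γ * ρ + ∫ z, max (g z + M - τ) 0 ∂P₀)) / α :=
    div_nonneg (by linarith) hα.le
  linarith

theorem tendsto_integral_neg_tail {X : Type*} [MeasurableSpace X] {μ : Measure X} {f : X → ℝ}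
    (hf : Integrable f μ) :
    Filter.Tendsto (fun n : ℕ => ∫ x, max (-f x - n) 0 ∂μ) Filter.atTop (nhds 0) := by
  have := tendsto_integral_of_dominated_convergence (μ := μ)
    (F := fun (n : ℕ) x => max (-f x - n) 0) (f := fun _ => 0) (fun x => |f x|) (fun n => ?_) hf.abs
    (fun n => Filter.Eventually.of_forall fun x => ?_) (Filter.Eventually.of_forall fun x => ?_)
  · simpa using this
  · exact (hf.aestronglyMeasurable.neg.sub aestronglyMeasurable_const).sup
      aestronglyMeasurable_const
  · rw [Real.norm_eq_abs, abs_of_nonneg (le_max_right _ _)]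
    exact max_le (by linarith [neg_le_abs (f x), (n.cast_nonneg : (0 : ℝ) ≤ n)]) (abs_nonneg _)
  · obtain ⟨N, hN⟩ := exists_nat_ge (-f x)
    refine tendsto_const_nhds.congr' ?_
    filter_upwards [Filter.eventually_ge_atTop N] with n hn
    have : (N : ℝ) ≤ n := by exact_mod_cast hn
    rw [max_eq_right (by linarith)]

end Transport

section Quadratic

variable {E : Type*} [NormedAddCommGroup E] [InnerProductSpace ℝ E]

theorem abs_inner_quadratic_le (B : E →L[ℝ] E) (q z : E) :
    |⟪z, B z⟫ + 2 * ⟪q, z⟫| ≤ (‖B‖ + ‖q‖) * (1 + ‖z‖ ^ 2) := by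
  have h1 : |⟪z, B z⟫| ≤ ‖z‖ * (‖B‖ * ‖z‖) :=
    (abs_real_inner_le_norm _ _).trans (by gcongr; exact B.le_opNorm z)
  have h2 := abs_real_inner_le_norm q z
  have h3 : |⟪z, B z⟫ + 2 * ⟪q, z⟫| ≤ |⟪z, B z⟫| + 2 * |⟪q, z⟫| :=
    (abs_add_le _ _).trans_eq (by rw [abs_mul, abs_two])
  nlinarith [norm_nonneg B, mul_nonneg (norm_nonneg q) (sq_nonneg (‖z‖ - 1))]

/-- Completing the square in the penalised quadratic loss. -/
theorem inner_quadratic_sub_penalty {B R : E →ₗ[ℝ] E} (hB : B.IsSymmetric) {γ : ℝ}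
    (hR : ∀ u, γ • R u - B (R u) = u) (q x z : E) :
    ⟪x, B x⟫ + 2 * ⟪q, x⟫ - γ * ‖x - z‖ ^ 2 =
      ⟪γ • z + q, R (γ • z + q)⟫ - γ * ‖z‖ ^ 2
        - (γ * ‖x - R (γ • z + q)‖ ^ 2
          - ⟪x - R (γ • z + q), B (x - R (γ • z + q))⟫) := by
  set y := R (γ • z + q) with hy
  have hyq : γ • z + q = γ • y - B y := (hR _).symm
  have hq : q = γ • y - B y - γ • z := by rw [← hyq]; abel
  have hs : ⟪y, B x⟫ = ⟪x, B y⟫ := by rw [← hB y x, real_inner_comm]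
  rw [hyq, hq]
  simp only [map_sub, inner_sub_left, inner_sub_right, inner_smul_left, ← real_inner_self_eq_norm_sq,
    real_inner_comm x y, real_inner_comm x z, real_inner_comm x (B y),
    real_inner_comm y (B y), RCLike.conj_to_real, hs]
  ring

theorem nonpos_of_forall_mul_sq_le {a c : ℝ} (h : ∀ s : ℝ, a * s ^ 2 ≤ c) : a ≤ 0 := by
  by_contra! ha
  have h1 := h (|c| / a + 1)
  have h2 : a * (|c| / a) = |c| := mul_div_cancel₀ _ ha.ne'
  have h3 : 0 ≤ |c| / a := by positivity
  nlinarith [le_abs_self c, mul_nonneg ha.le h3, mul_nonneg ha.le (sq_nonneg (|c| / a))]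

variable [MeasurableSpace E] [BorelSpace E] [SecondCountableTopology E]

/-- A Lagrangian bound over all partial transports forces the penalty to dominate the quadratic
form of the loss. -/
theorem inner_le_of_lagrangian_le {P₀ : Measure E} [IsProbabilityMeasure P₀]
    (hP₀ : Integrable (fun z => ‖z‖ ^ 2) P₀) (B : E →L[ℝ] E) (q : E) {α ρ M t τ γ : ℝ}
    (h : ∀ μ, IsPartialTransport P₀ μ →
      ∫ p, ((⟪p.1, B p.1⟫ + 2 * ⟪q, p.1⟫) + M) ∂μ + τ * (α - μ.real Set.univ)
        + γ * (ρ - ∫ p, ‖p.1 - p.2‖ ^ 2 ∂μ) ≤ t) (u : E) :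
    ⟪u, B u⟫ ≤ γ * ‖u‖ ^ 2 := by
  set ℓ : E → ℝ := fun z => ⟪z, B z⟫ + 2 * ⟪q, z⟫ with hℓ
  have hℓc : Continuous ℓ := by fun_prop
  have hshift : ∀ w : E, Integrable (fun z => ℓ (z + w)) P₀ ∧
      ∫ z, ℓ (z + w) ∂P₀ + M + τ * (α - 1) + γ * (ρ - ‖w‖ ^ 2) ≤ t := by
    intro w
    have hc : Integrable (fun z => ‖(z + w) - z‖ ^ 2) P₀ := by
      simp only [add_sub_cancel_left]; exact integrable_const _
    have hpt := isPartialTransport_map le_rfl (T := fun z => z + w) (by fun_prop) hc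
    have hi := hpt.integrable_fst hP₀ hℓc.measurable (abs_inner_quadratic_le B q)
    rw [integrable_map_measure (by fun_prop) (by fun_prop)] at hi
    have := h _ hpt
    rw [integral_map (by fun_prop) (by fun_prop), integral_map (by fun_prop) (by fun_prop),
      map_measureReal_apply (by fun_prop) MeasurableSet.univ, Set.preimage_univ] at this
    simp only [add_sub_cancel_left, integral_const, probReal_univ, smul_eq_mul, one_mul] at this
    rw [integral_add (f := fun z => ℓ (z + w)) hi (integrable_const M)] at this
    simp only [integral_const, probReal_univ, smul_eq_mul, one_mul] at this
    exact ⟨hi, this⟩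
  have hℓi : Integrable ℓ P₀ := by simpa using (hshift 0).1
  have := nonpos_of_forall_mul_sq_le (a := ⟪u, B u⟫ - γ * ‖u‖ ^ 2)
    (c := t - ∫ z, ℓ z ∂P₀ - M - τ * (α - 1) - γ * ρ) fun s => by
      obtain ⟨i1, h1⟩ := hshift (s • u)
      obtain ⟨i2, h2⟩ := hshift (-(s • u))
      have hsum : ∫ z, ℓ (z + s • u) ∂P₀ + ∫ z, ℓ (z + -(s • u)) ∂P₀ =
          2 * ∫ z, ℓ z ∂P₀ + 2 * s ^ 2 * ⟪u, B u⟫ := by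
        rw [← integral_add i1 i2]
        have e : (fun z => ℓ (z + s • u) + ℓ (z + -(s • u))) =
            fun z => 2 * ℓ z + 2 * s ^ 2 * ⟪u, B u⟫ := by
          funext z
          simp only [hℓ, map_add, map_neg, map_smul, inner_add_left, inner_add_right,
            inner_neg_left, inner_neg_right, inner_smul_left, inner_smul_right,
            RCLike.conj_to_real]
          ring
        rw [e, integral_add (hℓi.const_mul 2) (integrable_const _), integral_const_mul]
        simp
      rw [norm_neg] at h2
      rw [norm_smul, mul_pow, Real.norm_eq_abs, sq_abs] at h1 h2
      linarith
  linarith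

theorem integrable_norm_sq_clm_sub {P₀ : Measure E} [IsFiniteMeasure P₀]
    (hP₀ : Integrable (fun z => ‖z‖ ^ 2) P₀) (R : E →L[ℝ] E) (γ : ℝ) (q : E) :
    Integrable (fun z => ‖R (γ • z + q) - z‖ ^ 2) P₀ := by
  refine integrable_of_abs_le_one_add_sq hP₀ (A := (‖R‖ * |γ| + 1 + ‖R‖ * ‖q‖) ^ 2 * 2)
    (by fun_prop) fun z => ?_
  rw [abs_of_nonneg (by positivity)]
  have h1 : ‖R (γ • z + q) - z‖ ≤ (‖R‖ * |γ| + 1 + ‖R‖ * ‖q‖) * (1 + ‖z‖) := by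
    calc ‖R (γ • z + q) - z‖ ≤ ‖R (γ • z + q)‖ + ‖z‖ := norm_sub_le _ _
      _ ≤ ‖R‖ * (|γ| * ‖z‖ + ‖q‖) + ‖z‖ := by
        gcongr
        refine (R.le_opNorm _).trans ?_
        gcongr
        refine (norm_add_le _ _).trans_eq ?_
        rw [norm_smul, Real.norm_eq_abs]
      _ ≤ _ := by
        have : 0 ≤ ‖R‖ * |γ| := by positivity
        have : 0 ≤ ‖R‖ * ‖q‖ * ‖z‖ := by positivity
        nlinarith
  calc ‖R (γ • z + q) - z‖ ^ 2 ≤ ((‖R‖ * |γ| + 1 + ‖R‖ * ‖q‖) * (1 + ‖z‖)) ^ 2 := by gcongr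
    _ = (‖R‖ * |γ| + 1 + ‖R‖ * ‖q‖) ^ 2 * (1 + ‖z‖) ^ 2 := mul_pow _ _ _
    _ ≤ (‖R‖ * |γ| + 1 + ‖R‖ * ‖q‖) ^ 2 * (2 * (1 + ‖z‖ ^ 2)) := by
        gcongr
        nlinarith [sq_nonneg (‖z‖ - 1)]
    _ = _ := by ring

end Quadratic

section Matrix

variable {d : ℕ}

theorem inner_toEuclideanLin_smul_one_sub (Q : Matrix (Fin d) (Fin d) ℝ) (γ : ℝ)
    (u : EuclideanSpace ℝ (Fin d)) :
    ⟪u, Matrix.toEuclideanLin (γ • (1 : Matrix (Fin d) (Fin d) ℝ) - Q) u⟫ =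
      γ * ‖u‖ ^ 2 - ⟪u, Matrix.toEuclideanLin Q u⟫ := by
  have h : Matrix.toEuclideanLin (γ • (1 : Matrix (Fin d) (Fin d) ℝ) - Q) u =
      γ • u - Matrix.toEuclideanLin Q u := by
    simp [map_sub, Matrix.toLpLin_apply]
  rw [h, inner_sub_right, inner_smul_right, real_inner_self_eq_norm_sq]

theorem star_dotProduct_mulVec_eq_inner (M : Matrix (Fin d) (Fin d) ℝ) (x : Fin d → ℝ) :
    star x ⬝ᵥ M.mulVec x = ⟪WithLp.toLp 2 x, Matrix.toEuclideanLin M (WithLp.toLp 2 x)⟫ := by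
  rw [Matrix.toLpLin_apply, EuclideanSpace.inner_toLp_toLp, dotProduct_comm]

theorem posDef_add_smul_one_sub {Q : Matrix (Fin d) (Fin d) ℝ} (hQ : Q.IsSymm) {γ δ : ℝ}
    (hδ : 0 < δ) (h : ∀ u, ⟪u, Matrix.toEuclideanLin Q u⟫ ≤ γ * ‖u‖ ^ 2) :
    ((γ + δ) • (1 : Matrix (Fin d) (Fin d) ℝ) - Q).PosDef := by
  refine Matrix.PosDef.of_dotProduct_mulVec_pos ?_ fun x hx => ?_
  · rw [Matrix.IsHermitian, Matrix.conjTranspose_eq_transpose_of_trivial, Matrix.transpose_sub,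
      Matrix.transpose_smul, Matrix.transpose_one, hQ]
  · rw [star_dotProduct_mulVec_eq_inner, inner_toEuclideanLin_smul_one_sub]
    have : 0 < ‖WithLp.toLp 2 x‖ := by simpa using hx
    have : 0 < δ * ‖WithLp.toLp 2 x‖ ^ 2 := by positivity
    linarith [h (WithLp.toLp 2 x)]

theorem inner_le_of_posDef {Q : Matrix (Fin d) (Fin d) ℝ} {γ : ℝ}
    (h : (γ • (1 : Matrix (Fin d) (Fin d) ℝ) - Q).PosDef) (u : EuclideanSpace ℝ (Fin d)) :
    ⟪u, Matrix.toEuclideanLin Q u⟫ ≤ γ * ‖u‖ ^ 2 := by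
  have h1 := h.posSemidef.dotProduct_mulVec_nonneg u.ofLp
  rw [star_dotProduct_mulVec_eq_inner, inner_toEuclideanLin_smul_one_sub] at h1
  simpa using h1

theorem smul_inv_sub_toEuclideanLin_inv {Q : Matrix (Fin d) (Fin d) ℝ} {γ : ℝ}
    (h : (γ • (1 : Matrix (Fin d) (Fin d) ℝ) - Q).PosDef) (u : EuclideanSpace ℝ (Fin d)) :
    γ • Matrix.toEuclideanLin (γ • (1 : Matrix (Fin d) (Fin d) ℝ) - Q)⁻¹ u -
      Matrix.toEuclideanLin Q
        (Matrix.toEuclideanLin (γ • (1 : Matrix (Fin d) (Fin d) ℝ) - Q)⁻¹ u) = u := by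
  set N := γ • (1 : Matrix (Fin d) (Fin d) ℝ) - Q with hN
  have hmul : N * N⁻¹ = 1 := Matrix.mul_nonsing_inv _ ((Matrix.isUnit_iff_isUnit_det _).1 h.isUnit)
  have h1 : Matrix.toEuclideanLin N (Matrix.toEuclideanLin N⁻¹ u) = u := by
    simp [Matrix.toLpLin_apply, Matrix.mulVec_mulVec, hmul]
  have h2 : ∀ w, Matrix.toEuclideanLin N w = γ • w - Matrix.toEuclideanLin Q w := by
    intro w
    simp [hN, map_sub, Matrix.toLpLin_apply]
  rw [← h2, h1]

end Matrix

theorem CVaR_lt_top {E : Type*} [MeasurableSpace E] {P : Measure E} {α : ℝ} {f : E → ℝ}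
    (hf : Integrable f P) : CVaR α P f < ⊤ := by
  refine (iInf_le _ 0).trans_lt ?_
  have h : ∫⁻ z, ENNReal.ofReal (f z - 0) ∂P ≠ ⊤ := by
    simp only [sub_zero]
    exact hf.lintegral_lt_top.ne
  lift ∫⁻ z, ENNReal.ofReal (f z - 0) ∂P to NNReal using h with L
  have : ((L : ℝ≥0∞) : EReal) = ((L : ℝ) : EReal) := rfl
  rw [this, ← EReal.coe_mul, ← EReal.coe_add]
  exact EReal.coe_lt_top _

/-- **Theorem 2 (dual reformulation of quadratic worst-case CVaR).**
For `r > 0`, `α ∈ (0,1]`, symmetric `Q` and `q ∈ ℝ^d`, the worst-case CVaR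
`sup_{P∈𝒫} CVaR_P^α(zᵀQz + 2qᵀz)` is finite and equals
`inf_{γ∈Γ} CVaR_{P₀}^α((γz+q)ᵀ Q_γ⁻¹ (γz+q) + γ(r²/α − ‖z‖²))`,
where `Q_γ = γI − Q` and `Γ = {γ ≥ 0 : Q_γ ≻ 0}`. -/
theorem worst_case_CVaR_quadratic_dual {d : ℕ} (r α : ℝ) (hr : 0 < r)
    (hα : α ∈ Set.Ioc (0 : ℝ) 1)
    (Q : Matrix (Fin d) (Fin d) ℝ) (hQ : Q.IsSymm) (q : EuclideanSpace ℝ (Fin d))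
    (P₀ : Measure (EuclideanSpace ℝ (Fin d))) [IsProbabilityMeasure P₀]
    (hP₀ : Integrable (fun z => ‖z‖ ^ 2) P₀) :
    ∃ v : ℝ,
      (⨆ (P : Measure (EuclideanSpace ℝ (Fin d))) (_ : MemAmbiguity P₀ r P),
          CVaR α P (fun z => ⟪z, Matrix.toEuclideanLin Q z⟫ + 2 * ⟪q, z⟫)) = (v : EReal)
      ∧ (⨅ (γ : ℝ) (_ : 0 ≤ γ ∧ (γ • (1 : Matrix (Fin d) (Fin d) ℝ) - Q).PosDef),
          CVaR α P₀ (fun z =>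
            ⟪γ • z + q, Matrix.toEuclideanLin (γ • (1 : Matrix (Fin d) (Fin d) ℝ) - Q)⁻¹ (γ • z + q)⟫
              + γ * (r ^ 2 / α - ‖z‖ ^ 2))) = (v : EReal) := by
  obtain ⟨hα0, hα1⟩ := hα
  have hr2 : 0 < r ^ 2 := by positivity
  set B : EuclideanSpace ℝ (Fin d) →L[ℝ] EuclideanSpace ℝ (Fin d) :=
    LinearMap.toContinuousLinearMap (Matrix.toEuclideanLin Q) with hB
  set ℓ : EuclideanSpace ℝ (Fin d) → ℝ :=
    fun z => ⟪z, Matrix.toEuclideanLin Q z⟫ + 2 * ⟪q, z⟫ with hℓ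
  have hℓm : Measurable ℓ := by
    have : Continuous fun z => ⟪z, B z⟫ + 2 * ⟪q, z⟫ := by fun_prop
    exact this.measurable
  have hℓA : ∀ z, |ℓ z| ≤ (‖B‖ + ‖q‖) * (1 + ‖z‖ ^ 2) := abs_inner_quadratic_le B q
  have hBsymm : (Matrix.toEuclideanLin Q).IsSymmetric :=
    Matrix.isSymmetric_toEuclideanLin_iff.2
      (by rw [Matrix.IsHermitian, Matrix.conjTranspose_eq_transpose_of_trivial, hQ])
  set R : ℝ → EuclideanSpace ℝ (Fin d) →L[ℝ] EuclideanSpace ℝ (Fin d) := fun γ =>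
    LinearMap.toContinuousLinearMap
      (Matrix.toEuclideanLin (γ • (1 : Matrix (Fin d) (Fin d) ℝ) - Q)⁻¹) with hR
  set g : ℝ → EuclideanSpace ℝ (Fin d) → ℝ :=
    fun γ z => ⟪γ • z + q, R γ (γ • z + q)⟫ - γ * ‖z‖ ^ 2 with hg
  have hgm : ∀ γ, Measurable (g γ) := fun γ => by
    have : Continuous (g γ) := by fun_prop
    exact this.measurable
  have hdual : ∀ γ : ℝ, (fun z => ⟪γ • z + q,
      Matrix.toEuclideanLin (γ • (1 : Matrix (Fin d) (Fin d) ℝ) - Q)⁻¹ (γ • z + q)⟫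
        + γ * (r ^ 2 / α - ‖z‖ ^ 2)) = fun z => g γ z + γ * (r ^ 2 / α) := by
    intro γ; funext z
    simp only [hg, hR, LinearMap.coe_toContinuousLinearMap']
    ring
  simp only [hdual]
  have hsq : ∀ γ : ℝ, (γ • (1 : Matrix (Fin d) (Fin d) ℝ) - Q).PosDef → ∀ x z,
      ℓ x - γ * ‖x - z‖ ^ 2 = g γ z - (γ * ‖x - R γ (γ • z + q)‖ ^ 2
        - ⟪x - R γ (γ • z + q), Matrix.toEuclideanLin Q (x - R γ (γ • z + q))⟫) :=
    fun γ hγ x z =>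
      inner_quadratic_sub_penalty hBsymm (smul_inv_sub_toEuclideanLin_inv hγ) q x z
  have hgT : ∀ γ : ℝ, (γ • (1 : Matrix (Fin d) (Fin d) ℝ) - Q).PosDef → ∀ z,
      ℓ (R γ (γ • z + q)) - γ * ‖R γ (γ • z + q) - z‖ ^ 2 = g γ z := fun γ hγ z => by
    rw [hsq γ hγ]; simp
  have hcost : ∀ γ, Integrable (fun z => ‖R γ (γ • z + q) - z‖ ^ 2) P₀ := fun γ =>
    integrable_norm_sq_clm_sub hP₀ (R γ) γ q
  have hTm : ∀ γ, Measurable fun z => R γ (γ • z + q) := fun γ => by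
    have : Continuous fun z => R γ (γ • z + q) := by fun_prop
    exact this.measurable
  set V : EReal := ⨆ (P : Measure (EuclideanSpace ℝ (Fin d))) (_ : MemAmbiguity P₀ r P),
    CVaR α P ℓ with hV
  set D : EReal := ⨅ (γ : ℝ) (_ : 0 ≤ γ ∧ (γ • (1 : Matrix (Fin d) (Fin d) ℝ) - Q).PosDef),
    CVaR α P₀ (fun z => g γ z + γ * (r ^ 2 / α)) with hD
  have hweak : V ≤ D := by
    refine iSup₂_le fun P hP => le_iInf₂ fun γ hγ => ?_
    refine CVaR_le_of_penalized hα0 hγ.1 hP hℓm (hgm γ) fun x z => ?_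
    rw [hsq γ hγ.2]
    linarith [inner_le_of_posDef hγ.2 (x - R γ (γ • z + q))]
  have hDtop : D < ⊤ := by
    have hPD : ((‖B‖ + 1) • (1 : Matrix (Fin d) (Fin d) ℝ) - Q).PosDef := by
      refine posDef_add_smul_one_sub hQ one_pos fun u => ?_
      calc ⟪u, B u⟫ ≤ ‖u‖ * ‖B u‖ := real_inner_le_norm _ _
        _ ≤ ‖u‖ * (‖B‖ * ‖u‖) := by gcongr; exact B.le_opNorm u
        _ = ‖B‖ * ‖u‖ ^ 2 := by ring
    refine (iInf₂_le (‖B‖ + 1) ⟨by positivity, hPD⟩).trans_lt (CVaR_lt_top ?_)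
    have hi := (integrable_comp_of_integrable_cost hP₀ hℓm hℓA (hTm (‖B‖ + 1))
      (hcost (‖B‖ + 1))).sub ((hcost (‖B‖ + 1)).const_mul (‖B‖ + 1))
    have he : (fun z => ℓ (R (‖B‖ + 1) ((‖B‖ + 1) • z + q))) -
        (fun z => (‖B‖ + 1) * ‖R (‖B‖ + 1) ((‖B‖ + 1) • z + q) - z‖ ^ 2) = g (‖B‖ + 1) :=
      funext (hgT _ hPD)
    rw [he] at hi
    exact hi.add (integrable_const _)
  have hprimal : ∀ (M : ℝ) (μ : Measure _), IsPartialTransport P₀ μ → μ.real Set.univ ≤ α →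
      ∫ p, ‖p.1 - p.2‖ ^ 2 ∂μ ≤ r ^ 2 →
      (((∫ p, (ℓ p.1 + M) ∂μ - ∫ z, max (-ℓ z - M) 0 ∂P₀) / α - M : ℝ) : EReal) ≤ V := by
    intro M μ hμ hm hc
    obtain ⟨P, hP, hle⟩ := hμ.exists_memAmbiguity_le_CVaR hP₀ hℓm hℓA hα0 hα1 hm hc M
    exact hle.trans (le_iSup₂_of_le P hP le_rfl)
  have hVbot : ⊥ < V := (EReal.bot_lt_coe _).trans_le
    (hprimal 0 0 (isPartialTransport_zero P₀) (by simpa using hα0.le) (by simpa using hr2.le))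
  have hVtop : V < ⊤ := hweak.trans_lt hDtop
  have hvV : ((V.toReal : ℝ) : EReal) = V := EReal.coe_toReal hVtop.ne hVbot.ne'
  set v := V.toReal
  have hbound : ∀ (n : ℕ) (δ : ℝ), 0 < δ →
      D ≤ ((v + (∫ z, max (-ℓ z - n) 0 ∂P₀) / α + δ * r ^ 2 / α : ℝ) : EReal) := by
    intro n δ hδ
    set e := ∫ z, max (-ℓ z - n) 0 ∂P₀
    obtain ⟨τ, γ, -, hγ, H⟩ := exists_multipliers_of_partialTransport_le hP₀ hℓm hℓA
      (M := (n : ℝ)) (t := α * (v + n) + e) hα0 hr2 fun μ hμ hm hc => by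
        have h1 := hprimal n μ hμ hm hc
        rw [← hvV, EReal.coe_le_coe_iff, sub_le_iff_le_add, div_le_iff₀ hα0] at h1
        linarith
    have hPD : ((γ + δ) • (1 : Matrix (Fin d) (Fin d) ℝ) - Q).PosDef :=
      posDef_add_smul_one_sub hQ hδ (inner_le_of_lagrangian_le hP₀ B q H)
    refine (iInf₂_le (γ + δ) ⟨by positivity, hPD⟩).trans ?_
    refine (CVaR_le_of_lagrangian_le (M := (n : ℝ)) (τ := τ) (t := α * (v + n) + e + δ * r ^ 2)
      hP₀ hℓm hℓA (hTm (γ + δ)) (hcost (γ + δ)) hα0 (hgT _ hPD) fun μ hμ => ?_).trans_eq ?_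
    · have h0 : 0 ≤ ∫ p, ‖p.1 - p.2‖ ^ 2 ∂μ := integral_nonneg fun p => by positivity
      linarith [H μ hμ, mul_nonneg hδ.le h0]
    · congr 1
      field_simp
      ring
  refine ⟨v, hvV.symm, le_antisymm ?_ (hvV.trans_le hweak)⟩
  have hlim : Filter.Tendsto (fun n : ℕ => v + (∫ z, max (-ℓ z - n) 0 ∂P₀) / α
      + (1 / ((n : ℝ) + 1)) * r ^ 2 / α) Filter.atTop (nhds (v + 0 / α + 0 * r ^ 2 / α)) :=
    (tendsto_const_nhds.add ((tendsto_integral_neg_tail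
      (integrable_of_abs_le_one_add_sq hP₀ hℓm hℓA)).div_const α)).add
      ((tendsto_one_div_add_atTop_nhds_zero_nat.mul_const _).div_const α)
  simp only [zero_div, zero_mul, add_zero] at hlim
  exact ge_of_tendsto' ((continuous_coe_real_ereal.tendsto v).comp hlim)
    fun n => hbound n _ (by positivity)

end
end

section
/- Let Q ∈ 𝕊^d be a symmetric matrix, q, z ∈ ℝ^d, τ ∈ ℝ, and γ ≥ 0 such that Q_γ := γI − Q is positive definite. Then sup_{v∈ℝ^d} { (vᵀQv + 2qᵀv − τ)₊ − γ‖v − z‖² } = ( (γz+q)ᵀ Q_γ^{-1} (γz+q) − γ‖z‖² − τ )₊. -/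
open RealInnerProductSpace

noncomputable section

/-- Completing the square for the quadratic form `⟪v, (γ - T) v⟫` at a solution of
`T w = γ z + q`. -/
theorem LinearMap.IsSymmetric.complete_square {E : Type*} [NormedAddCommGroup E]
    [InnerProductSpace ℝ E] {T : E →ₗ[ℝ] E} (hT : T.IsSymmetric) {q z w : E} {γ : ℝ}
    (hw : T w = γ • z + q) (v : E) :
    ⟪v, γ • v - T v⟫ + 2 * ⟪q, v⟫ - γ * ‖v - z‖ ^ 2 =
      ⟪γ • z + q, w⟫ - γ * ‖z‖ ^ 2 - ⟪T (v - w), v - w⟫ := by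
  have hvw : ⟪T v, w⟫ = ⟪γ • z + q, v⟫ := by rw [hT, hw, real_inner_comm]
  rw [map_sub, inner_sub_left, inner_sub_right, inner_sub_right, hvw, hw, inner_sub_right,
    real_inner_comm (T v) v, norm_sub_sq_real, inner_add_left, inner_add_left,
    inner_smul_left, inner_smul_left, inner_smul_right, real_inner_self_eq_norm_sq,
    real_inner_comm v z]
  simp only [conj_trivial]
  ring

/-- For a positive operator `T`, the positive part of the quadratic `⟪v, (γ - T) v⟫ + 2⟪q, v⟫ - τ`,
penalized by `γ‖v - z‖²`, has the positive part of the unconstrained maximum as its supremum. -/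
theorem LinearMap.IsPositive.isLUB_quadratic_positive_part {E : Type*} [NormedAddCommGroup E]
    [InnerProductSpace ℝ E] {T : E →ₗ[ℝ] E} (hT : T.IsPositive) {q z w : E} {γ : ℝ} (τ : ℝ)
    (hγ : 0 ≤ γ) (hw : T w = γ • z + q) :
    IsLUB
      (Set.range fun v : E => max (⟪v, γ • v - T v⟫ + 2 * ⟪q, v⟫ - τ) 0 - γ * ‖v - z‖ ^ 2)
      (max (⟪γ • z + q, w⟫ - γ * ‖z‖ ^ 2 - τ) 0) := by
  have hsq := hT.isSymmetric.complete_square hw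
  constructor
  · rintro _ ⟨v, rfl⟩
    have hpos : 0 ≤ ⟪T (v - w), v - w⟫ := hT.2 (v - w)
    have hnorm : 0 ≤ γ * ‖v - z‖ ^ 2 := by positivity
    rw [sub_le_iff_le_add]
    refine max_le ?_ (by positivity)
    linarith [hsq v, le_max_left (⟪γ • z + q, w⟫ - γ * ‖z‖ ^ 2 - τ) 0]
  · intro c hc
    have hcw := hc (Set.mem_range_self w)
    have hcz := hc (Set.mem_range_self z)
    have hsqw := hsq w
    simp only [sub_self, map_zero, inner_zero_left, sub_zero] at hsqw
    simp only [sub_self, norm_zero, ne_eq, OfNat.ofNat_ne_zero, not_false_eq_true, zero_pow,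
      mul_zero, sub_zero] at hcz
    refine max_le ?_ ((le_max_right _ _).trans hcz)
    linarith [le_max_left (⟪w, γ • w - T w⟫ + 2 * ⟪q, w⟫ - τ) 0]

/-- **Closed form for the inner supremum.** For symmetric `Q`, `γ ≥ 0` with
`Q_γ := γI − Q ≻ 0`, the supremum of `v ↦ (vᵀQv + 2qᵀv − τ)₊ − γ‖v − z‖²` equals
`((γz+q)ᵀ Q_γ⁻¹ (γz+q) − γ‖z‖² − τ)₊`. -/
theorem sup_quadratic_positive_part {d : ℕ} (Q : Matrix (Fin d) (Fin d) ℝ) (hQ : Q.IsSymm)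
    (q z : EuclideanSpace ℝ (Fin d)) (τ γ : ℝ) (hγ : 0 ≤ γ)
    (hPD : (γ • (1 : Matrix (Fin d) (Fin d) ℝ) - Q).PosDef) :
    IsLUB
      (Set.range fun v : EuclideanSpace ℝ (Fin d) =>
        max (⟪v, Matrix.toEuclideanLin Q v⟫ + 2 * ⟪q, v⟫ - τ) 0 - γ * ‖v - z‖ ^ 2)
      (max (⟪γ • z + q,
          Matrix.toEuclideanLin (γ • (1 : Matrix (Fin d) (Fin d) ℝ) - Q)⁻¹ (γ • z + q)⟫
            - γ * ‖z‖ ^ 2 - τ) 0) := by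
  set A : Matrix (Fin d) (Fin d) ℝ := γ • 1 - Q with hA
  have hQA (v : EuclideanSpace ℝ (Fin d)) :
      Matrix.toEuclideanLin Q v = γ • v - Matrix.toEuclideanLin A v := by
    ext i
    simp [hA]
  have hinv (b : EuclideanSpace ℝ (Fin d)) :
      Matrix.toEuclideanLin A (Matrix.toEuclideanLin A⁻¹ b) = b := by
    ext i
    simp [Matrix.mulVec_mulVec, Matrix.mul_nonsing_inv A hPD.det_pos.ne'.isUnit]
  simp only [hQA]
  exact (Matrix.isPositive_toEuclideanLin_iff.mpr hPD.posSemidef).isLUB_quadratic_positive_part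
    τ hγ (hinv _)

end
end

section
/- Let Q ∈ 𝕊^d be a symmetric matrix, q, z ∈ ℝ^d, τ ∈ ℝ, and γ ≥ 0. If the matrix γI − Q is not positive semidefinite, then the function v ↦ (vᵀQv + 2qᵀv − τ)₊ − γ‖v − z‖² is unbounded above on ℝ^d (its supremum is +∞). -/
open RealInnerProductSpace

noncomputable section

/-- A real quadratic polynomial with positive leading coefficient is unbounded above. -/
theorem exists_lt_quadratic {a : ℝ} (ha : 0 < a) (b c M : ℝ) :
    ∃ t : ℝ, M < a * t ^ 2 + b * t + c := by
  by_contra! h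
  have key : ∀ t : ℝ, a * t ^ 2 ≤ M - c := fun t => by
    have h₁ := h t
    have h₂ := h (-t)
    linarith [neg_sq t]
  have h₀ := key 0
  have h₁ := key ((M - c) / a + 1)
  have h₂ : a * ((M - c) / a) = M - c := by field_simp
  have h₃ : 0 ≤ (M - c) / a := div_nonneg (by linarith) ha.le
  nlinarith [mul_nonneg ha.le (sq_nonneg ((M - c) / a))]

/-- A symmetric matrix `Q` such that `γI − Q` is not positive semidefinite has a vector on which
its quadratic form exceeds `γ‖·‖²`. -/
theorem exists_lt_inner_toEuclideanLin {d : ℕ} {Q : Matrix (Fin d) (Fin d) ℝ} (hQ : Q.IsSymm)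
    {γ : ℝ} (h : ¬ (γ • (1 : Matrix (Fin d) (Fin d) ℝ) - Q).PosSemidef) :
    ∃ u : EuclideanSpace ℝ (Fin d), γ * ‖u‖ ^ 2 < ⟪u, Matrix.toEuclideanLin Q u⟫ := by
  by_contra! hle
  refine h (Matrix.PosSemidef.of_dotProduct_mulVec_nonneg ?_ fun x => ?_)
  · simp [Matrix.IsHermitian, Matrix.conjTranspose_eq_transpose_of_trivial, hQ.eq]
  · have hx := hle (WithLp.toLp 2 x)
    rw [← real_inner_self_eq_norm_sq] at hx
    simp only [EuclideanSpace.inner_eq_star_dotProduct, Matrix.toLpLin_apply,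
      star_trivial] at hx
    rw [star_trivial, Matrix.sub_mulVec, Matrix.smul_mulVec, Matrix.one_mulVec, dotProduct_sub,
      dotProduct_smul, smul_eq_mul, dotProduct_comm x (Q.mulVec x)]
    linarith

/-- **Unboundedness when `γI − Q` is not positive semidefinite.** If `γ ≥ 0` and
`γI − Q` is not positive semidefinite, then `v ↦ (vᵀQv + 2qᵀv − τ)₊ − γ‖v − z‖²`
is unbounded above on `ℝ^d`. -/
theorem sup_quadratic_unbounded {d : ℕ} (Q : Matrix (Fin d) (Fin d) ℝ) (hQ : Q.IsSymm)
    (q z : EuclideanSpace ℝ (Fin d)) (τ γ : ℝ) (hγ : 0 ≤ γ)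
    (hNPSD : ¬ (γ • (1 : Matrix (Fin d) (Fin d) ℝ) - Q).PosSemidef) :
    ¬ BddAbove
      (Set.range fun v : EuclideanSpace ℝ (Fin d) =>
        max (⟪v, Matrix.toEuclideanLin Q v⟫ + 2 * ⟪q, v⟫ - τ) 0 - γ * ‖v - z‖ ^ 2) := by
  obtain ⟨u, hu⟩ := exists_lt_inner_toEuclideanLin hQ hNPSD
  rintro ⟨M, hM⟩
  obtain ⟨t, ht⟩ := exists_lt_quadratic (sub_pos.mpr hu)
    (2 * ⟪q, u⟫ + 2 * γ * ⟪u, z⟫) (-τ - γ * ‖z‖ ^ 2) M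
  have hle := hM (Set.mem_range_self (t • u))
  have hmax := le_max_left
    (⟪t • u, Matrix.toEuclideanLin Q (t • u)⟫ + 2 * ⟪q, t • u⟫ - τ) 0
  simp only [norm_sub_sq_real, norm_smul, mul_pow, Real.norm_eq_abs, sq_abs, map_smul,
    real_inner_smul_left, real_inner_smul_right] at hle hmax
  linarith

end
end

section
/- Let Q ∈ 𝕊^d be a symmetric matrix, q, z ∈ ℝ^d, and τ ∈ ℝ. Then the function γ ↦ ( (γz+q)ᵀ (γI − Q)^{-1} (γz+q) − γ‖z‖² − τ )₊ is convex on the set Γ := {γ ≥ 0 : γI − Q ≻ 0}. -/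
open RealInnerProductSpace

noncomputable section

open Matrix in
theorem toEuclideanLin_apply_inv_apply {d : ℕ} {M : Matrix (Fin d) (Fin d) ℝ} (hM : M.PosDef)
    (b : EuclideanSpace ℝ (Fin d)) : toEuclideanLin M (toEuclideanLin M⁻¹ b) = b := by
  have h : IsUnit M.det := (isUnit_iff_isUnit_det M).1 hM.isUnit
  ext i
  simp [toLpLin_apply, mulVec_mulVec, mul_nonsing_inv M h]

open Matrix in
/-- The quadratic form of `M⁻¹` is bounded below by the concave quadratics `2⟪b, x⟫ - ⟪x, M x⟫`. -/
theorem two_mul_inner_sub_le_inner_inv {d : ℕ} {M : Matrix (Fin d) (Fin d) ℝ} (hM : M.PosDef)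
    (b x : EuclideanSpace ℝ (Fin d)) :
    2 * ⟪b, x⟫ - ⟪x, toEuclideanLin M x⟫ ≤ ⟪b, toEuclideanLin M⁻¹ b⟫ := by
  have hs := isSymmetric_toEuclideanLin_iff.2 hM.isHermitian
  have hp := (isPositive_toEuclideanLin_iff.2 hM.posSemidef).inner_nonneg_right
    (x - toEuclideanLin M⁻¹ b)
  have hy := toEuclideanLin_apply_inv_apply hM b
  have hyx := hs (toEuclideanLin M⁻¹ b) x
  rw [hy] at hyx
  rw [map_sub, hy, inner_sub_left, inner_sub_right, inner_sub_right, ← hyx,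
    real_inner_comm b x, real_inner_comm b (toEuclideanLin M⁻¹ b)] at hp
  linarith

open Matrix in
/-- The bound `two_mul_inner_sub_le_inner_inv` is attained at `x = M⁻¹ b`. -/
theorem two_mul_inner_sub_eq_inner_inv {d : ℕ} {M : Matrix (Fin d) (Fin d) ℝ} (hM : M.PosDef)
    (b : EuclideanSpace ℝ (Fin d)) :
    2 * ⟪b, toEuclideanLin M⁻¹ b⟫ - ⟪toEuclideanLin M⁻¹ b, toEuclideanLin M (toEuclideanLin M⁻¹ b)⟫
      = ⟪b, toEuclideanLin M⁻¹ b⟫ := by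
  rw [toEuclideanLin_apply_inv_apply hM, real_inner_comm b (toEuclideanLin M⁻¹ b)]
  ring

/-- **Convexity in `γ`.** For symmetric `Q`, `q, z ∈ ℝ^d` and `τ ∈ ℝ`, the map
`γ ↦ ((γz+q)ᵀ (γI − Q)⁻¹ (γz+q) − γ‖z‖² − τ)₊` is convex on
`Γ = {γ ≥ 0 : γI − Q ≻ 0}`. -/
theorem posPart_dual_convex_in_gamma {d : ℕ} (Q : Matrix (Fin d) (Fin d) ℝ) (hQ : Q.IsSymm)
    (q z : EuclideanSpace ℝ (Fin d)) (τ : ℝ) :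
    ConvexOn ℝ {γ : ℝ | 0 ≤ γ ∧ (γ • (1 : Matrix (Fin d) (Fin d) ℝ) - Q).PosDef}
      (fun γ : ℝ =>
        max (⟪γ • z + q,
            Matrix.toEuclideanLin (γ • (1 : Matrix (Fin d) (Fin d) ℝ) - Q)⁻¹ (γ • z + q)⟫
          - γ * ‖z‖ ^ 2 - τ) 0) := by
  have hconv : Convex ℝ {γ : ℝ | 0 ≤ γ ∧ (γ • (1 : Matrix (Fin d) (Fin d) ℝ) - Q).PosDef} := by
    rintro s ⟨hs, hsM⟩ t ⟨ht, htM⟩ a b ha hb hab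
    refine ⟨by positivity, ?_⟩
    have key : (a • s + b • t) • (1 : Matrix (Fin d) (Fin d) ℝ) - Q
        = a • (s • (1 : Matrix (Fin d) (Fin d) ℝ) - Q)
          + b • (t • (1 : Matrix (Fin d) (Fin d) ℝ) - Q) := by
      obtain rfl : b = 1 - a := by linarith
      module
    rw [key]
    rcases ha.eq_or_lt with rfl | ha
    · obtain rfl : b = 1 := by linarith
      simpa using htM
    · exact (hsM.smul ha).add_posSemidef (htM.posSemidef.smul hb)
  refine ConvexOn.sup ⟨hconv, ?_⟩ (convexOn_const 0 hconv)
  intro s hs t ht a b ha hb hab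
  have hr := hconv hs ht ha hb hab
  beta_reduce
  have hmax := two_mul_inner_sub_eq_inner_inv hr.2 ((a • s + b • t) • z + q)
  set x := Matrix.toEuclideanLin ((a • s + b • t) • (1 : Matrix (Fin d) (Fin d) ℝ) - Q)⁻¹
    ((a • s + b • t) • z + q)
  have h₁ := two_mul_inner_sub_le_inner_inv hs.2 (s • z + q) x
  have h₂ := two_mul_inner_sub_le_inner_inv ht.2 (t • z + q) x
  have hexp (r : ℝ) : 2 * ⟪r • z + q, x⟫
      - ⟪x, Matrix.toEuclideanLin (r • (1 : Matrix (Fin d) (Fin d) ℝ) - Q) x⟫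
      = r * (2 * ⟪z, x⟫ - ⟪x, x⟫) + (2 * ⟪q, x⟫ + ⟪x, Matrix.toEuclideanLin Q x⟫) := by
    simp only [map_sub, map_smul, LinearMap.sub_apply, LinearMap.smul_apply, inner_add_left,
      inner_sub_right, inner_smul_left, inner_smul_right, Matrix.toLpLin_one, LinearMap.id_apply]
    simp
    ring
  rw [hexp] at h₁ h₂ hmax
  have h₁' := mul_le_mul_of_nonneg_left h₁ ha
  have h₂' := mul_le_mul_of_nonneg_left h₂ hb
  obtain rfl : b = 1 - a := by linarith
  simp only [smul_eq_mul] at hmax ⊢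
  linarith

end
end

section
/- Let F ∈ ℝ^{n×d}, b ∈ ℝ^n, z ∈ ℝ^d, and s, τ, γ ∈ ℝ, and suppose γ I_d − FᵀF is positive definite. Then the scalar inequality s ≥ (γz + Fᵀb)ᵀ (γ I_d − FᵀF)^{-1} (γz + Fᵀb) + bᵀb − γ‖z‖² − τ holds if and only if the (1+d+n)×(1+d+n) block matrix [[τ + s + γ‖z‖², γ zᵀ, −bᵀ],[γ z, γ I_d, Fᵀ],[−b, F, I_n]] is positive semidefinite. -/
open Matrix RealInnerProductSpace

noncomputable section

/-- **Bordered Schur complement criterion.** For positive definite `P`, the symmetric bordered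
matrix `[[c, wᵀ], [w, P]]` is positive semidefinite iff `wᵀ P⁻¹ w ≤ c`. -/
theorem Matrix.PosDef.posSemidef_bordered_iff {m : Type*} [Fintype m] [DecidableEq m]
    {P : Matrix m m ℝ} (hP : P.PosDef) (w : m → ℝ) (c : ℝ) :
    (Matrix.fromBlocks (Matrix.of fun (_ _ : Fin 1) => c) (Matrix.replicateRow (Fin 1) w)
      (Matrix.replicateCol (Fin 1) w) P).PosSemidef ↔ w ⬝ᵥ P⁻¹ *ᵥ w ≤ c := by
  have := hP.isUnit.invertible
  have hcol : Matrix.replicateCol (Fin 1) w = (Matrix.replicateRow (Fin 1) w)ᴴ := by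
    ext i j
    simp
  have hdiag : (Matrix.of fun (_ _ : Fin 1) => c) -
      Matrix.replicateRow (Fin 1) w * P⁻¹ * (Matrix.replicateRow (Fin 1) w)ᴴ =
        Matrix.diagonal fun _ => c - w ⬝ᵥ P⁻¹ *ᵥ w := by
    ext i j
    rw [Subsingleton.elim j i, ← hcol, Matrix.mul_assoc, ← Matrix.replicateCol_mulVec]
    simp [Matrix.mul_apply, dotProduct]
  rw [hcol, hP.fromBlocks₂₂, hdiag, Matrix.posSemidef_diagonal_iff]
  simp

/-- Eliminating the trailing identity block from a symmetric `3 × 3` block matrix whose leading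
block is a scalar. -/
theorem Matrix.posSemidef_fromBlocks_one_iff {m k : Type*} [Fintype m] [Fintype k]
    [DecidableEq k] (A : Matrix m m ℝ) (F : Matrix k m ℝ) (a : m → ℝ) (b : k → ℝ) (c : ℝ) :
    (Matrix.fromBlocks (Matrix.of fun (_ _ : Fin 1) => c)
      (Matrix.replicateRow (Fin 1) (Sum.elim a (-b)))
      (Matrix.replicateCol (Fin 1) (Sum.elim a (-b)))
      (Matrix.fromBlocks A Fᵀ F 1)).PosSemidef ↔
    (Matrix.fromBlocks (Matrix.of fun (_ _ : Fin 1) => c - b ⬝ᵥ b)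
      (Matrix.replicateRow (Fin 1) (a + Fᵀ *ᵥ b))
      (Matrix.replicateCol (Fin 1) (a + Fᵀ *ᵥ b))
      (A - Fᵀ * F)).PosSemidef := by
  let B : Matrix (Fin 1 ⊕ m) k ℝ := Matrix.fromRows (Matrix.replicateRow (Fin 1) (-b)) Fᵀ
  let A' : Matrix (Fin 1 ⊕ m) (Fin 1 ⊕ m) ℝ :=
    Matrix.fromBlocks (Matrix.of fun _ _ => c) (Matrix.replicateRow (Fin 1) a)
      (Matrix.replicateCol (Fin 1) a) A
  rw [← Matrix.posSemidef_submatrix_equiv (Equiv.sumAssoc (Fin 1) m k)]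
  have hassoc : (Matrix.fromBlocks (Matrix.of fun (_ _ : Fin 1) => c)
      (Matrix.replicateRow (Fin 1) (Sum.elim a (-b)))
      (Matrix.replicateCol (Fin 1) (Sum.elim a (-b)))
      (Matrix.fromBlocks A Fᵀ F 1)).submatrix (Equiv.sumAssoc (Fin 1) m k)
        (Equiv.sumAssoc (Fin 1) m k) = Matrix.fromBlocks A' B Bᴴ 1 := by
    ext ((i | i) | i) ((j | j) | j) <;> simp [A', B]
  have : Invertible (1 : Matrix k k ℝ) := invertibleOne
  rw [hassoc, Matrix.PosDef.one.fromBlocks₂₂]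
  refine iff_of_eq (congrArg _ ?_)
  ext (i | i) (j | j) <;>
    simp [A', B, Matrix.mul_apply, Matrix.mulVec, dotProduct, mul_comm]

/-- **Schur complement characterization of the epigraph constraint.** With
`γ I_d − FᵀF ≻ 0`, the scalar inequality
`s ≥ (γz + Fᵀb)ᵀ (γI_d − FᵀF)⁻¹ (γz + Fᵀb) + bᵀb − γ‖z‖² − τ`
holds iff the block matrix
`[[τ + s + γ‖z‖², γzᵀ, −bᵀ], [γz, γI_d, Fᵀ], [−b, F, I_n]]` is positive semidefinite. -/
theorem epigraph_constraint_iff_posSemidef {n d : ℕ} (F : Matrix (Fin n) (Fin d) ℝ)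
    (b : EuclideanSpace ℝ (Fin n)) (z : EuclideanSpace ℝ (Fin d)) (s τ γ : ℝ)
    (hPD : (γ • (1 : Matrix (Fin d) (Fin d) ℝ) - Fᵀ * F).PosDef) :
    (s ≥ ⟪γ • z + Matrix.toEuclideanLin Fᵀ b,
          Matrix.toEuclideanLin (γ • (1 : Matrix (Fin d) (Fin d) ℝ) - Fᵀ * F)⁻¹
            (γ • z + Matrix.toEuclideanLin Fᵀ b)⟫
        + ⟪b, b⟫ - γ * ‖z‖ ^ 2 - τ)
      ↔ (Matrix.fromBlocks
          (Matrix.of fun (_ : Fin 1) (_ : Fin 1) => τ + s + γ * ‖z‖ ^ 2)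
          (Matrix.of fun (_ : Fin 1) (j : Fin d ⊕ Fin n) =>
            Sum.elim (fun jd => γ * z jd) (fun jn => -(b jn)) j)
          (Matrix.of fun (i : Fin d ⊕ Fin n) (_ : Fin 1) =>
            Sum.elim (fun id => γ * z id) (fun jn => -(b jn)) i)
          (Matrix.fromBlocks (γ • (1 : Matrix (Fin d) (Fin d) ℝ)) Fᵀ
            F (1 : Matrix (Fin n) (Fin n) ℝ))).PosSemidef := by
  have hmat := (Matrix.posSemidef_fromBlocks_one_iff (γ • (1 : Matrix (Fin d) (Fin d) ℝ)) F
    (γ • z.ofLp) b.ofLp (τ + s + γ * ‖z‖ ^ 2)).trans (hPD.posSemidef_bordered_iff _ _)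
  have hb : ⟪b, b⟫ = b.ofLp ⬝ᵥ b.ofLp := by
    rw [EuclideanSpace.inner_eq_star_dotProduct, star_trivial]
  have hw : ⟪γ • z + Matrix.toEuclideanLin Fᵀ b,
      Matrix.toEuclideanLin (γ • (1 : Matrix (Fin d) (Fin d) ℝ) - Fᵀ * F)⁻¹
        (γ • z + Matrix.toEuclideanLin Fᵀ b)⟫ =
      (γ • z.ofLp + Fᵀ *ᵥ b.ofLp) ⬝ᵥ (γ • (1 : Matrix (Fin d) (Fin d) ℝ) - Fᵀ * F)⁻¹ *ᵥ
        (γ • z.ofLp + Fᵀ *ᵥ b.ofLp) := by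
    rw [EuclideanSpace.inner_eq_star_dotProduct, dotProduct_comm]
    rfl
  rw [hb, hw]
  refine Iff.trans ?_ hmat.symm
  constructor <;> intro h <;> linarith

end
end

section
/- Let r > 0, Q ∈ 𝕊^d a symmetric matrix, q ∈ ℝ^d, and P₀ ∈ 𝓜(ℝ^d). Then the worst-case expectation sup_{P∈𝒫} E_P[ zᵀQz + 2qᵀz ] is finite and equals inf_{γ∈Γ} { γ r² + E_{P₀}[ (γz+q)ᵀ Q_γ^{-1} (γz+q) − γ‖z‖² ] }, where Q_γ := γI − Q and Γ := {γ ≥ 0 : Q_γ ≻ 0}. (This is the α = 1 risk-neutral special case of the distributionally robust CVaR duality, valid for an arbitrary nominal distribution with finite second moment.) -/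
open MeasureTheory RealInnerProductSpace ENNReal

noncomputable section

/-- The quadratic objective `⟪z, A z⟫ + 2 ⟪q, z⟫`. -/
def quadObjective {E : Type*} [NormedAddCommGroup E] [InnerProductSpace ℝ E]
    (A : E →ₗ[ℝ] E) (q z : E) : ℝ :=
  ⟪z, A z⟫ + 2 * ⟪q, z⟫

/-- The integrand `⟪γ z + q, R (γ z + q)⟫ - γ ‖z‖²` of the dual objective, where `R` plays the
role of `(γ - A)⁻¹`. -/
def dualIntegrand {E : Type*} [NormedAddCommGroup E] [InnerProductSpace ℝ E]
    (R : E →ₗ[ℝ] E) (γ : ℝ) (q z : E) : ℝ :=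
  ⟪γ • z + q, R (γ • z + q)⟫ - γ * ‖z‖ ^ 2

section Algebra

variable {E : Type*} [NormedAddCommGroup E] [InnerProductSpace ℝ E]

lemma quadObjective_eq_dualIntegrand {A R : E →ₗ[ℝ] E} (hA : A.IsSymmetric) {γ : ℝ}
    (hR : ∀ x, γ • R x - A (R x) = x) (q z y : E) :
    quadObjective A q y = dualIntegrand R γ q z + γ * ‖y - z‖ ^ 2 -
      (γ * ‖y - R (γ • z + q)‖ ^ 2 -
        ⟪y - R (γ • z + q), A (y - R (γ • z + q))⟫) := by
  have h := hR (γ • z + q)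
  unfold quadObjective dualIntegrand
  set w := R (γ • z + q) with hw
  have h1 : ⟪γ • z + q, w⟫ = γ * ⟪w, w⟫ - ⟪w, A w⟫ := by
    conv_lhs => rw [← h]
    rw [inner_sub_left, real_inner_smul_left, real_inner_comm w (A w)]
  have h2 : γ * ⟪y, z⟫ + ⟪q, y⟫ = γ * ⟪y, w⟫ - ⟪y, A w⟫ := by
    have := congrArg (fun x => ⟪y, x⟫) h
    simp only [inner_sub_right, inner_add_right, real_inner_smul_right] at this
    rw [real_inner_comm y q]
    linarith
  have h3 : ⟪w, A y⟫ = ⟪y, A w⟫ := by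
    rw [← hA w y, real_inner_comm]
  rw [h1, norm_sub_sq_real, norm_sub_sq_real, map_sub, inner_sub_left, inner_sub_right,
    inner_sub_right, h3, real_inner_self_eq_norm_sq]
  linarith

lemma quadObjective_le_dualIntegrand {A R : E →ₗ[ℝ] E} (hA : A.IsSymmetric) {γ : ℝ}
    (hR : ∀ x, γ • R x - A (R x) = x) (hpos : ∀ x, x ≠ 0 → 0 < γ * ‖x‖ ^ 2 - ⟪x, A x⟫)
    (q z y : E) :
    quadObjective A q y ≤ dualIntegrand R γ q z + γ * ‖y - z‖ ^ 2 := by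
  rw [quadObjective_eq_dualIntegrand hA hR q z y]
  rcases eq_or_ne (y - R (γ • z + q)) 0 with h | h
  · rw [h]
    simp
  · linarith [hpos _ h]

variable {ι : Type*} [Fintype ι]

lemma inner_apply_eigenvector {A : E →ₗ[ℝ] E} (hA : A.IsSymmetric) {u : E} {l : ℝ}
    (hu : A u = l • u) (x : E) : ⟪u, A x⟫ = l * ⟪u, x⟫ := by
  rw [← hA u x, hu, real_inner_smul_left]

lemma sub_inner_apply_self_pos {A : E →ₗ[ℝ] E} (hA : A.IsSymmetric)
    (u : OrthonormalBasis ι ℝ E) {l : ι → ℝ} (hu : ∀ i, A (u i) = l i • u i) {γ : ℝ}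
    (hγ : ∀ i, l i < γ) {x : E} (hx : x ≠ 0) : 0 < γ * ‖x‖ ^ 2 - ⟪x, A x⟫ := by
  have h1 : γ * ‖x‖ ^ 2 - ⟪x, A x⟫ = ∑ i, (γ - l i) * ⟪u i, x⟫ ^ 2 := by
    rw [← u.sum_inner_mul_inner x (A x), ← u.sum_sq_inner_right x, Finset.mul_sum,
      ← Finset.sum_sub_distrib]
    refine Finset.sum_congr rfl fun i _ => ?_
    rw [inner_apply_eigenvector hA (hu i), real_inner_comm]
    ring
  have h2 : ∃ i, ⟪u i, x⟫ ≠ 0 := by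
    by_contra! h
    apply hx
    rw [← norm_eq_zero, ← sq_eq_zero_iff, ← u.sum_sq_inner_right x]
    simp [h]
  obtain ⟨i, hi⟩ := h2
  rw [h1]
  refine Finset.sum_pos' (fun j _ => mul_nonneg (sub_pos.2 (hγ j)).le (sq_nonneg _))
    ⟨i, Finset.mem_univ _, ?_⟩
  have := sub_pos.2 (hγ i)
  positivity

lemma norm_resolvent_sub_sq {A R : E →ₗ[ℝ] E} (hA : A.IsSymmetric)
    (u : OrthonormalBasis ι ℝ E) {l : ι → ℝ} (hu : ∀ i, A (u i) = l i • u i) {γ : ℝ}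
    (hγ : ∀ i, l i < γ) (hR : ∀ x, γ • R x - A (R x) = x) (q z : E) :
    ‖R (γ • z + q) - z‖ ^ 2 = ∑ i, ⟪u i, A z + q⟫ ^ 2 / (γ - l i) ^ 2 := by
  rw [← u.sum_sq_inner_right]
  refine Finset.sum_congr rfl fun i _ => ?_
  have hne : γ - l i ≠ 0 := (sub_pos.2 (hγ i)).ne'
  have h := congrArg (fun x => ⟪u i, x⟫) (hR (γ • z + q))
  simp only [inner_sub_right, inner_add_right, real_inner_smul_right,
    inner_apply_eigenvector hA (hu i)] at h
  rw [← div_pow, inner_sub_right, inner_add_right, inner_apply_eigenvector hA (hu i)]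
  congr 1
  field_simp
  linarith

end Algebra

section Integrability

variable {E : Type*} [NormedAddCommGroup E] [InnerProductSpace ℝ E]

lemma MeasureTheory.MemLp.integrable_real_inner {α : Type*} [MeasurableSpace α] {μ : Measure α}
    {f g : α → E} (hf : MemLp f 2 μ) (hg : MemLp g 2 μ) :
    Integrable (fun a => ⟪f a, g a⟫) μ := by
  have hf2 := hf.integrable_norm_pow two_ne_zero
  have hg2 := hg.integrable_norm_pow two_ne_zero
  refine (hf2.add hg2).mono' (hf.1.inner hg.1) (ae_of_all _ fun a => ?_)
  have := norm_inner_le_norm (𝕜 := ℝ) (f a) (g a)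
  simp only [Pi.add_apply]
  nlinarith [sq_nonneg (‖f a‖ - ‖g a‖), sq_nonneg (‖f a‖ + ‖g a‖)]

/-- A square-integrable field of mean square at most `r²` can be translated along a unit vector,
by a bounded amount, to one of mean square exactly `r²`. -/
lemma exists_translation_integral_norm_sq_eq {α : Type*} [MeasurableSpace α]
    {μ : Measure α} [IsProbabilityMeasure μ] {D : α → E} (hD : MemLp D 2 μ) {r : ℝ}
    (hr : ∫ z, ‖D z‖ ^ 2 ∂μ ≤ r ^ 2) {v : E} (hv : ‖v‖ = 1) :
    ∃ c : ℝ, c ^ 2 ≤ 4 * r ^ 2 ∧ ∫ z, ‖D z + c • v‖ ^ 2 ∂μ = r ^ 2 := by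
  have hI := hD.integrable_norm_pow two_ne_zero
  have hb := hD.integrable_real_inner (memLp_const v)
  set h := ∫ z, ‖D z‖ ^ 2 ∂μ
  set b := ∫ z, ⟪D z, v⟫ ∂μ
  have key : ∀ c : ℝ, ∫ z, ‖D z + c • v‖ ^ 2 ∂μ = h + 2 * c * b + c ^ 2 := by
    intro c
    have : ∀ z, ‖D z + c • v‖ ^ 2 = ‖D z‖ ^ 2 + 2 * c * ⟪D z, v⟫ + c ^ 2 := by
      intro z
      rw [norm_add_sq_real, real_inner_smul_right, norm_smul, hv, mul_one, Real.norm_eq_abs,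
        sq_abs]
      ring
    simp_rw [this]
    rw [integral_add (by exact hI.add (hb.const_mul _)) (integrable_const _),
      integral_add hI (hb.const_mul _), integral_const_mul]
    simp [h, b]
  have hbh : b ^ 2 ≤ h := by
    have h0 : 0 ≤ ∫ z, ‖D z + (-b) • v‖ ^ 2 ∂μ := integral_nonneg fun z => by positivity
    rw [key] at h0
    linarith
  have hs := Real.sq_sqrt (show 0 ≤ b ^ 2 + r ^ 2 - h by nlinarith [sq_nonneg b])
  refine ⟨-b + √(b ^ 2 + r ^ 2 - h), ?_, ?_⟩
  · nlinarith [sq_nonneg (b + √(b ^ 2 + r ^ 2 - h))]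
  · rw [key]
    linarith

variable [FiniteDimensional ℝ E]

lemma LinearMap.memLp_comp {α : Type*} [MeasurableSpace α] {μ : Measure α} {p : ℝ≥0∞}
    (L : E →ₗ[ℝ] E) {f : α → E} (hf : MemLp f p μ) : MemLp (fun a => L (f a)) p μ :=
  (LinearMap.toContinuousLinearMap L).comp_memLp' hf

lemma integrable_quadObjective {α : Type*} [MeasurableSpace α] {μ : Measure α}
    [IsFiniteMeasure μ] (A : E →ₗ[ℝ] E) (q : E) {f : α → E} (hf : MemLp f 2 μ) :
    Integrable (fun a => quadObjective A q (f a)) μ :=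
  (hf.integrable_real_inner (A.memLp_comp hf)).add
    (((memLp_const q).integrable_real_inner hf).const_mul 2)

lemma integrable_dualIntegrand {α : Type*} [MeasurableSpace α] {μ : Measure α}
    [IsFiniteMeasure μ] (R : E →ₗ[ℝ] E) (γ : ℝ) (q : E) {f : α → E} (hf : MemLp f 2 μ) :
    Integrable (fun a => dualIntegrand R γ q (f a)) μ := by
  have h : MemLp (fun a => γ • f a + q) 2 μ := (hf.const_smul γ).add (memLp_const q)
  exact (h.integrable_real_inner (R.memLp_comp h)).sub
    ((hf.integrable_norm_pow two_ne_zero).const_mul γ)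

end Integrability

section Transport

variable {E : Type*} [NormedAddCommGroup E] [InnerProductSpace ℝ E] [FiniteDimensional ℝ E]
  [MeasurableSpace E] [BorelSpace E]

lemma memLp_id_two {P : Measure E} (hP : Integrable (fun z => ‖z‖ ^ 2) P) :
    MemLp (fun z : E => z) 2 P :=
  (memLp_two_iff_integrable_sq_norm (by fun_prop)).2 hP

lemma memAmbiguity_map {P₀ : Measure E} [IsProbabilityMeasure P₀] {r : ℝ} {T : E → E}
    (hP₀ : Integrable (fun z => ‖z‖ ^ 2) P₀) (hTc : Continuous T) (hT : MemLp T 2 P₀)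
    (hr : ∫ z, ‖T z - z‖ ^ 2 ∂P₀ ≤ r ^ 2) : MemAmbiguity P₀ r (P₀.map T) := by
  have hTm : Measurable T := hTc.measurable
  refine ⟨Measure.isProbabilityMeasure_map hTm.aemeasurable, ?_, ?_⟩
  · rw [integrable_map_measure (by fun_prop) hTm.aemeasurable]
    exact hT.integrable_norm_pow two_ne_zero
  · have hm : Measurable fun z => (T z, z) := hTm.prodMk measurable_id
    have hc : IsCoupling (P₀.map fun z => (T z, z)) (P₀.map T) P₀ := by
      refine ⟨Measure.isProbabilityMeasure_map hm.aemeasurable, ?_, ?_⟩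
      · rw [Measure.map_map measurable_fst hm]; rfl
      · rw [Measure.map_map measurable_snd hm]
        exact Measure.map_id
    refine (iInf₂_le (f := fun π (_ : IsCoupling π (P₀.map T) P₀) =>
      ∫⁻ p, ENNReal.ofReal (‖p.1 - p.2‖ ^ 2) ∂π) _ hc).trans ?_
    rw [lintegral_map (by fun_prop) hm, ← ofReal_integral_eq_lintegral_ofReal]
    · exact ENNReal.ofReal_le_ofReal hr
    · exact (hT.sub (memLp_id_two hP₀)).integrable_norm_pow two_ne_zero
    · exact ae_of_all _ fun z => by positivity

lemma integral_quadObjective_le_dual {A R : E →ₗ[ℝ] E} (hA : A.IsSymmetric) {γ : ℝ}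
    (hγ : 0 ≤ γ) (hR : ∀ x, γ • R x - A (R x) = x)
    (hpos : ∀ x, x ≠ 0 → 0 < γ * ‖x‖ ^ 2 - ⟪x, A x⟫) (q : E) {P₀ P : Measure E} {r : ℝ}
    (hP₀ : Integrable (fun z => ‖z‖ ^ 2) P₀) (hP : MemAmbiguity P₀ r P) :
    ∫ z, quadObjective A q z ∂P ≤ γ * r ^ 2 + ∫ z, dualIntegrand R γ q z ∂P₀ := by
  obtain ⟨hPp, hP2, hW⟩ := hP
  have key : ∀ ε : ℝ, 0 < ε →
      ∫ z, quadObjective A q z ∂P ≤ γ * (r ^ 2 + ε) + ∫ z, dualIntegrand R γ q z ∂P₀ := by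
    intro ε hε
    have hlt : W2sq P P₀ < ENNReal.ofReal (r ^ 2 + ε) :=
      hW.trans_lt ((ENNReal.ofReal_lt_ofReal_iff (by positivity)).2 (by linarith))
    unfold W2sq at hlt
    simp only [iInf_lt_iff] at hlt
    obtain ⟨π, ⟨hπ, h1, h2⟩, hlt⟩ := hlt
    have m1 : MemLp (fun p : E × E => p.1) 2 π := by
      have := memLp_id_two hP2
      rw [← h1, memLp_map_measure_iff (by fun_prop) (by fun_prop)] at this
      exact this
    have m2 : MemLp (fun p : E × E => p.2) 2 π := by
      have := memLp_id_two hP₀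
      rw [← h2, memLp_map_measure_iff (by fun_prop) (by fun_prop)] at this
      exact this
    have hI : Integrable (fun p : E × E => ‖p.1 - p.2‖ ^ 2) π :=
      (m1.sub m2).integrable_norm_pow two_ne_zero
    have hcost : ∫ p, ‖p.1 - p.2‖ ^ 2 ∂π ≤ r ^ 2 + ε := by
      rw [← ofReal_integral_eq_lintegral_ofReal hI (ae_of_all _ fun p => by positivity)] at hlt
      exact ((ENNReal.ofReal_lt_ofReal_iff (by positivity)).1 hlt).le
    have hd := integrable_dualIntegrand R γ q m2
    have e1 : ∫ z, quadObjective A q z ∂P = ∫ p, quadObjective A q p.1 ∂π := by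
      conv_lhs => rw [← h1]
      refine integral_map (by fun_prop) ?_
      rw [h1]
      exact (integrable_quadObjective A q (memLp_id_two hP2)).1
    have e2 : ∫ z, dualIntegrand R γ q z ∂P₀ = ∫ p, dualIntegrand R γ q p.2 ∂π := by
      have : IsProbabilityMeasure P₀ := h2 ▸ Measure.isProbabilityMeasure_map (by fun_prop)
      conv_lhs => rw [← h2]
      refine integral_map (by fun_prop) ?_
      rw [h2]
      exact (integrable_dualIntegrand R γ q (memLp_id_two hP₀)).1
    rw [e1, e2]
    calc ∫ p, quadObjective A q p.1 ∂π
        ≤ ∫ p, (dualIntegrand R γ q p.2 + γ * ‖p.1 - p.2‖ ^ 2) ∂π :=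
          integral_mono (integrable_quadObjective A q m1) (hd.add (hI.const_mul γ)) fun p =>
            quadObjective_le_dualIntegrand hA hR hpos q p.2 p.1
      _ = ∫ p, dualIntegrand R γ q p.2 ∂π + γ * ∫ p, ‖p.1 - p.2‖ ^ 2 ∂π := by
          rw [integral_add hd (hI.const_mul γ), integral_const_mul]
      _ ≤ _ := by nlinarith
  refine le_of_forall_pos_le_add fun δ hδ => ?_
  have h := key (δ / (γ + 1)) (by positivity)
  have : γ * (δ / (γ + 1)) ≤ δ := by
    rw [mul_div_assoc', div_le_iff₀ (by positivity)]
    nlinarith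
  linarith

/-- Pushing `P₀` forward along the resolvent map, translated by a multiple of an eigenvector,
gives an explicit objective value. -/
lemma integral_quadObjective_map {A R : E →ₗ[ℝ] E} (hA : A.IsSymmetric) {γ : ℝ}
    (hR : ∀ x, γ • R x - A (R x) = x) (q : E) {P₀ : Measure E} [IsProbabilityMeasure P₀]
    (hP₀ : Integrable (fun z => ‖z‖ ^ 2) P₀) (a : E) :
    ∫ z, quadObjective A q z ∂(P₀.map fun z => R (γ • z + q) + a) =
      ∫ z, dualIntegrand R γ q z ∂P₀ + γ * ∫ z, ‖R (γ • z + q) + a - z‖ ^ 2 ∂P₀ -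
        (γ * ‖a‖ ^ 2 - ⟪a, A a⟫) := by
  have hz := memLp_id_two hP₀
  have hRc : Continuous R := R.continuous_of_finiteDimensional
  have hAc : Continuous A := A.continuous_of_finiteDimensional
  have hT : MemLp (fun z => R (γ • z + q) + a) 2 P₀ :=
    (R.memLp_comp ((hz.const_smul γ).add (memLp_const q))).add (memLp_const a)
  have hd := integrable_dualIntegrand R γ q hz
  have hI : Integrable (fun z => ‖R (γ • z + q) + a - z‖ ^ 2) P₀ :=
    (hT.sub hz).integrable_norm_pow two_ne_zero
  rw [integral_map (by fun_prop) (by unfold quadObjective; fun_prop)]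
  calc ∫ z, quadObjective A q (R (γ • z + q) + a) ∂P₀
      = ∫ z, (dualIntegrand R γ q z + γ * ‖R (γ • z + q) + a - z‖ ^ 2 -
          (γ * ‖a‖ ^ 2 - ⟪a, A a⟫)) ∂P₀ := by
        refine integral_congr_ae (ae_of_all _ fun z => ?_)
        simp only [quadObjective_eq_dualIntegrand hA hR q z, add_sub_cancel_left]
    _ = _ := by
        rw [integral_sub (by exact hd.add (hI.const_mul γ)) (integrable_const _),
          integral_add hd (hI.const_mul γ), integral_const_mul]
        simp

lemma memAmbiguity_map_resolvent {R : E →ₗ[ℝ] E} {γ r : ℝ} {q a : E} {P₀ : Measure E}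
    [IsProbabilityMeasure P₀] (hP₀ : Integrable (fun z => ‖z‖ ^ 2) P₀)
    (h : ∫ z, ‖R (γ • z + q) + a - z‖ ^ 2 ∂P₀ ≤ r ^ 2) :
    MemAmbiguity P₀ r (P₀.map fun z => R (γ • z + q) + a) := by
  have hRc : Continuous R := R.continuous_of_finiteDimensional
  exact memAmbiguity_map hP₀ (by fun_prop)
    ((R.memLp_comp (((memLp_id_two hP₀).const_smul γ).add (memLp_const q))).add
      (memLp_const a)) h

end Transport

section StrongDuality

open Filter Topology

variable {E : Type*} [NormedAddCommGroup E] [InnerProductSpace ℝ E] [FiniteDimensional ℝ E]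
  [MeasurableSpace E] [BorelSpace E] {ι : Type*} [Fintype ι]

lemma integral_norm_resolvent_sub_sq {A R : E →ₗ[ℝ] E} (hA : A.IsSymmetric)
    (u : OrthonormalBasis ι ℝ E) {l : ι → ℝ} (hu : ∀ i, A (u i) = l i • u i) {γ : ℝ}
    (hγ : ∀ i, l i < γ) (hR : ∀ x, γ • R x - A (R x) = x) (q : E) {P₀ : Measure E}
    [IsProbabilityMeasure P₀] (hP₀ : Integrable (fun z => ‖z‖ ^ 2) P₀) :
    ∫ z, ‖R (γ • z + q) - z‖ ^ 2 ∂P₀ =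
      ∑ i, (∫ z, ⟪u i, A z + q⟫ ^ 2 ∂P₀) / (γ - l i) ^ 2 := by
  simp_rw [norm_resolvent_sub_sq hA u hu hγ hR q]
  rw [integral_finsetSum]
  · simp_rw [integral_div]
  · intro i _
    have h : MemLp (fun z => A z + q) 2 P₀ :=
      (A.memLp_comp (memLp_id_two hP₀)).add (memLp_const q)
    have h' : MemLp (fun z => ⟪u i, A z + q⟫) 2 P₀ := h.const_inner (u i)
    exact h'.integrable_sq.div_const _

lemma exists_dual_le_integral_quadObjective_add {A : E →ₗ[ℝ] E} (hA : A.IsSymmetric)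
    (u : OrthonormalBasis ι ℝ E) {l : ι → ℝ} (hu : ∀ i, A (u i) = l i • u i)
    {R : ℝ → E →ₗ[ℝ] E}
    (hR : ∀ γ, 0 ≤ γ → (∀ i, l i < γ) → ∀ x, γ • R γ x - A (R γ x) = x)
    (q : E) {P₀ : Measure E} [IsProbabilityMeasure P₀]
    (hP₀ : Integrable (fun z => ‖z‖ ^ 2) P₀) {r : ℝ} (hr : 0 < r) {ε : ℝ} (hε : 0 < ε) :
    ∃ γ : ℝ, 0 ≤ γ ∧ (∀ i, l i < γ) ∧ ∃ P, MemAmbiguity P₀ r P ∧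
      γ * r ^ 2 + ∫ z, dualIntegrand (R γ) γ q z ∂P₀ ≤ ∫ z, quadObjective A q z ∂P + ε := by
  obtain ⟨m, hm0, hlm, hm⟩ : ∃ m : ℝ, 0 ≤ m ∧ (∀ i, l i ≤ m) ∧ (m = 0 ∨ ∃ i, l i = m) := by
    by_cases h : ∃ i, 0 ≤ l i
    · obtain ⟨i₀, hi₀⟩ := h
      obtain ⟨i, -, hi⟩ := Finset.exists_max_image Finset.univ l ⟨i₀, Finset.mem_univ _⟩
      exact ⟨l i, hi₀.trans (hi i₀ (Finset.mem_univ _)), fun j => hi j (Finset.mem_univ _),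
        Or.inr ⟨i, rfl⟩⟩
    · push Not at h
      exact ⟨0, le_rfl, fun i => (h i).le, Or.inl rfl⟩
  have hlt : ∀ γ, m < γ → ∀ i, l i < γ := fun γ hγ i => (hlm i).trans_lt hγ
  set h : ℝ → ℝ := fun γ => ∑ i, (∫ z, ⟪u i, A z + q⟫ ^ 2 ∂P₀) / (γ - l i) ^ 2 with hdef
  have hh : ∀ γ, m < γ → ∫ z, ‖R γ (γ • z + q) - z‖ ^ 2 ∂P₀ = h γ := fun γ hγ =>
    integral_norm_resolvent_sub_sq hA u hu (hlt γ hγ) (hR γ (hm0.trans hγ.le) (hlt γ hγ)) q hP₀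
  have hcont : ContinuousOn h (Set.Ioi m) := by
    refine continuousOn_finsetSum _ fun i _ => ContinuousOn.div (by fun_prop) (by fun_prop) ?_
    intro γ hγ
    have := sub_pos.2 (hlt γ hγ i)
    positivity
  have hlim : Tendsto h atTop (𝓝 0) := by
    rw [← Finset.sum_const_zero (s := (Finset.univ : Finset ι))]
    refine tendsto_finsetSum _ fun i _ => Tendsto.div_atTop tendsto_const_nhds ?_
    exact (tendsto_pow_atTop two_ne_zero).comp (tendsto_atTop_add_const_right _ (-l i) tendsto_id)
  by_cases hex : ∃ γ, m < γ ∧ r ^ 2 ≤ h γ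
  · obtain ⟨γ₁, hγ₁, hr₁⟩ := hex
    obtain ⟨γ₂, hγ₂, hr₂⟩ := ((eventually_gt_atTop γ₁).and
      (hlim.eventually (gt_mem_nhds (show (0 : ℝ) < r ^ 2 by positivity)))).exists
    obtain ⟨γ, hγ, hγr⟩ := intermediate_value_Icc' hγ₂.le
      (hcont.mono fun x hx => hγ₁.trans_le hx.1) ⟨hr₂.le, hr₁⟩
    have hmγ : m < γ := hγ₁.trans_le hγ.1
    have hRγ := hR γ (hm0.trans hmγ.le) (hlt γ hmγ)
    have hcost : ∫ z, ‖R γ (γ • z + q) + 0 - z‖ ^ 2 ∂P₀ = r ^ 2 := by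
      simp_rw [add_zero]
      rw [hh γ hmγ, hγr]
    refine ⟨γ, hm0.trans hmγ.le, hlt γ hmγ, _, memAmbiguity_map_resolvent hP₀ hcost.le, ?_⟩
    rw [integral_quadObjective_map hA hRγ q hP₀, hcost]
    simp only [map_zero, norm_zero, inner_zero_left]
    linarith
  · push Not at hex
    rcases hm with rfl | ⟨i, hi⟩
    · set γ := ε / r ^ 2 with hγdef
      have hγ : 0 < γ := by positivity
      have hRγ := hR γ hγ.le (hlt γ hγ)
      have hcost : ∫ z, ‖R γ (γ • z + q) + 0 - z‖ ^ 2 ∂P₀ = h γ := by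
        simp_rw [add_zero]
        exact hh γ hγ
      have h0 : 0 ≤ h γ := hcost ▸ integral_nonneg fun z => by positivity
      refine ⟨γ, hγ.le, hlt γ hγ, _,
        memAmbiguity_map_resolvent hP₀ (hcost.le.trans (hex γ hγ).le), ?_⟩
      rw [integral_quadObjective_map hA hRγ q hP₀, hcost]
      simp only [map_zero, norm_zero, inner_zero_left]
      have : γ * r ^ 2 = ε := by rw [hγdef]; field_simp
      nlinarith [mul_nonneg hγ.le h0]
    · set γ := m + ε / (4 * r ^ 2) with hγdef
      have hγ : m < γ := lt_add_of_pos_right _ (by positivity)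
      have hRγ := hR γ (hm0.trans hγ.le) (hlt γ hγ)
      have hz := memLp_id_two hP₀
      have hD : MemLp (fun z => R γ (γ • z + q) - z) 2 P₀ :=
        ((R γ).memLp_comp ((hz.const_smul γ).add (memLp_const q))).sub hz
      obtain ⟨c, hc, hcr⟩ := exists_translation_integral_norm_sq_eq hD
        ((hh γ hγ).le.trans (hex γ hγ).le) (u.norm_eq_one i)
      have hcost : ∫ z, ‖R γ (γ • z + q) + c • u i - z‖ ^ 2 ∂P₀ = r ^ 2 := by
        simp_rw [add_sub_right_comm]
        exact hcr
      refine ⟨γ, hm0.trans hγ.le, hlt γ hγ, _, memAmbiguity_map_resolvent hP₀ hcost.le, ?_⟩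
      rw [integral_quadObjective_map hA hRγ q hP₀, hcost, inner_smul_left, map_smul, hu i, hi,
        real_inner_smul_right, real_inner_smul_right, real_inner_self_eq_norm_sq, norm_smul,
        u.norm_eq_one i, mul_one, Real.norm_eq_abs, sq_abs]
      have h1 : (γ - m) * c ^ 2 ≤ ε := by
        calc (γ - m) * c ^ 2 ≤ (γ - m) * (4 * r ^ 2) :=
              mul_le_mul_of_nonneg_left hc (sub_pos.2 hγ).le
          _ = ε := by rw [hγdef]; field_simp; ring
      simp only [conj_trivial]
      nlinarith

end StrongDuality

lemma EReal.exists_coe_eq_iSup_and_iInf {α β : Type*} {p : α → Prop} {s : β → Prop}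
    {f : α → ℝ} {g : β → ℝ} (hfg : ∀ a, p a → ∀ b, s b → f a ≤ g b)
    (happrox : ∀ ε : ℝ, 0 < ε → ∃ b, s b ∧ ∃ a, p a ∧ g b ≤ f a + ε) :
    ∃ v : ℝ, (⨆ (a) (_ : p a), (f a : EReal)) = v ∧ (⨅ (b) (_ : s b), (g b : EReal)) = v := by
  obtain ⟨b₀, hb₀, a₀, ha₀, -⟩ := happrox 1 one_pos
  have hbot : (f a₀ : EReal) ≤ ⨆ (a) (_ : p a), (f a : EReal) :=
    le_iSup₂ (f := fun a (_ : p a) => (f a : EReal)) a₀ ha₀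
  have hle : ∀ b, s b → (⨆ (a) (_ : p a), (f a : EReal)) ≤ g b := fun b hb =>
    iSup₂_le fun a ha => EReal.coe_le_coe_iff.2 (hfg a ha b hb)
  obtain ⟨v, hv⟩ : ∃ v : ℝ, (⨆ (a) (_ : p a), (f a : EReal)) = v :=
    ⟨_, (EReal.coe_toReal (ne_top_of_le_ne_top (EReal.coe_ne_top _) (hle b₀ hb₀))
      (ne_bot_of_le_ne_bot (EReal.coe_ne_bot _) hbot)).symm⟩
  refine ⟨v, hv, le_antisymm ?_ (hv ▸ le_iInf₂ hle)⟩
  refine EReal.le_of_forall_lt_iff_le.1 fun x hx => ?_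
  obtain ⟨b, hb, a, ha, hab⟩ := happrox (x - v) 
    (_root_.sub_pos.2 (EReal.coe_lt_coe_iff.1 hx))
  refine (iInf₂_le b hb).trans (EReal.coe_le_coe_iff.2 ?_)
  have hav : f a ≤ v := EReal.coe_le_coe_iff.1
    (hv ▸ le_iSup₂ (f := fun a (_ : p a) => (f a : EReal)) a ha)
  linarith

section Matrix

open scoped Matrix

variable {d : ℕ}

lemma Matrix.toEuclideanLin_smul_one_sub_apply (γ : ℝ) (Q : Matrix (Fin d) (Fin d) ℝ)
    (x : EuclideanSpace ℝ (Fin d)) :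
    Matrix.toEuclideanLin (γ • (1 : Matrix (Fin d) (Fin d) ℝ) - Q) x =
      γ • x - Matrix.toEuclideanLin Q x := by
  rw [map_sub, map_smul, LinearMap.sub_apply, LinearMap.smul_apply]
  simp

lemma Matrix.posDef_smul_one_sub_iff {Q : Matrix (Fin d) (Fin d) ℝ} (hQ : Q.IsSymm) (γ : ℝ) :
    (γ • (1 : Matrix (Fin d) (Fin d) ℝ) - Q).PosDef ↔
      ∀ x : EuclideanSpace ℝ (Fin d), x ≠ 0 →
        0 < γ * ‖x‖ ^ 2 - ⟪x, Matrix.toEuclideanLin Q x⟫ := by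
  have hH : (γ • (1 : Matrix (Fin d) (Fin d) ℝ) - Q).IsHermitian := by
    rw [Matrix.IsHermitian, Matrix.conjTranspose_eq_transpose_of_trivial]
    simp [hQ.eq]
  have key : ∀ x : EuclideanSpace ℝ (Fin d),
      star x.ofLp ⬝ᵥ ((γ • (1 : Matrix (Fin d) (Fin d) ℝ) - Q) *ᵥ x.ofLp) =
        γ * ‖x‖ ^ 2 - ⟪x, Matrix.toEuclideanLin Q x⟫ := by
    intro x
    rw [← real_inner_self_eq_norm_sq, ← real_inner_smul_right, ← inner_sub_right,
      ← Matrix.toEuclideanLin_smul_one_sub_apply, EuclideanSpace.inner_eq_star_dotProduct,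
      dotProduct_comm]
    rfl
  rw [Matrix.posDef_iff_dotProduct_mulVec]
  refine ⟨fun h x hx => key x ▸ h.2 fun h0 => hx ?_, fun h => ⟨hH, fun x hx => ?_⟩⟩
  · ext i
    exact congrFun h0 i
  · have := h (WithLp.toLp 2 x) (by simpa using hx)
    rwa [← key] at this

lemma Matrix.smul_toEuclideanLin_inv_sub {Q : Matrix (Fin d) (Fin d) ℝ} {γ : ℝ}
    (h : (γ • (1 : Matrix (Fin d) (Fin d) ℝ) - Q).PosDef) (x : EuclideanSpace ℝ (Fin d)) :
    γ • Matrix.toEuclideanLin (γ • (1 : Matrix (Fin d) (Fin d) ℝ) - Q)⁻¹ x -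
      Matrix.toEuclideanLin Q
        (Matrix.toEuclideanLin (γ • (1 : Matrix (Fin d) (Fin d) ℝ) - Q)⁻¹ x) = x := by
  rw [← Matrix.toEuclideanLin_smul_one_sub_apply, ← LinearMap.comp_apply,
    ← Matrix.toLpLin_mul, Matrix.mul_nonsing_inv _ ((Matrix.isUnit_iff_isUnit_det _).1 h.isUnit)]
  simp

end Matrix

/-- **Dual reformulation of the quadratic worst-case expectation (risk-neutral case
`α = 1`).** For `r > 0`, symmetric `Q`, `q ∈ ℝ^d` and any nominal `P₀` with finite second
moment, `sup_{P∈𝒫} E_P[zᵀQz + 2qᵀz]` is finite and equals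
`inf_{γ∈Γ} { γr² + E_{P₀}[(γz+q)ᵀ Q_γ⁻¹ (γz+q) − γ‖z‖²] }` with `Q_γ = γI − Q` and
`Γ = {γ ≥ 0 : Q_γ ≻ 0}`. -/
theorem worst_case_expectation_quadratic_dual {d : ℕ} (r : ℝ) (hr : 0 < r)
    (Q : Matrix (Fin d) (Fin d) ℝ) (hQ : Q.IsSymm) (q : EuclideanSpace ℝ (Fin d))
    (P₀ : Measure (EuclideanSpace ℝ (Fin d))) [IsProbabilityMeasure P₀]
    (hP₀ : Integrable (fun z => ‖z‖ ^ 2) P₀) :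
    ∃ v : ℝ,
      (⨆ (P : Measure (EuclideanSpace ℝ (Fin d))) (_ : MemAmbiguity P₀ r P),
          ((∫ z, (⟪z, Matrix.toEuclideanLin Q z⟫ + 2 * ⟪q, z⟫) ∂P : ℝ) : EReal)) = (v : EReal)
      ∧ (⨅ (γ : ℝ) (_ : 0 ≤ γ ∧ (γ • (1 : Matrix (Fin d) (Fin d) ℝ) - Q).PosDef),
          ((γ * r ^ 2 +
            ∫ z, (⟪γ • z + q,
                Matrix.toEuclideanLin (γ • (1 : Matrix (Fin d) (Fin d) ℝ) - Q)⁻¹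
                  (γ • z + q)⟫ - γ * ‖z‖ ^ 2) ∂P₀ : ℝ) : EReal)) = (v : EReal) := by
  have hA : (Matrix.toEuclideanLin Q).IsSymmetric := by
    rw [Matrix.isSymmetric_toEuclideanLin_iff, Matrix.IsHermitian,
      Matrix.conjTranspose_eq_transpose_of_trivial, hQ.eq]
  have hn : Module.finrank ℝ (EuclideanSpace ℝ (Fin d)) = d := by simp
  have hu : ∀ i, Matrix.toEuclideanLin Q (hA.eigenvectorBasis hn i) =
      hA.eigenvalues hn i • hA.eigenvectorBasis hn i := fun i => by
    simp
  have hpd : ∀ γ : ℝ, (∀ i, hA.eigenvalues hn i < γ) →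
      (γ • (1 : Matrix (Fin d) (Fin d) ℝ) - Q).PosDef := fun γ hγ =>
    (Matrix.posDef_smul_one_sub_iff hQ γ).2 fun x hx =>
      sub_inner_apply_self_pos hA (hA.eigenvectorBasis hn) hu hγ hx
  refine EReal.exists_coe_eq_iSup_and_iInf
    (fun P hP γ ⟨hγ, hpos⟩ => integral_quadObjective_le_dual hA hγ
      (Matrix.smul_toEuclideanLin_inv_sub hpos)
      ((Matrix.posDef_smul_one_sub_iff hQ γ).1 hpos) q hP₀ hP) fun ε hε => ?_
  obtain ⟨γ, hγ, hl, P, hP, h⟩ := exists_dual_le_integral_quadObjective_add hA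
    (hA.eigenvectorBasis hn) hu
    (R := fun γ => Matrix.toEuclideanLin (γ • (1 : Matrix (Fin d) (Fin d) ℝ) - Q)⁻¹)
    (fun γ _ hγ => Matrix.smul_toEuclideanLin_inv_sub (hpd γ hγ)) q hP₀ hr hε
  exact ⟨γ, ⟨hγ, hpd γ hl⟩, P, hP, h⟩
end
end
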